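/- arXiv:1007.4357 — 2 statements merged into one kernel-verified Lean document; each statement's English description precedes it below -/
import Mathlib

section
/- Let A=(a_{ij})_{i,j∈I} be the Cartan matrix of a simply-laced semisimple Lie algebra (A symmetric, a_{ii}=2, a_{ij}∈{0,−1} for i≠j, and A positive definite), let 𝔤 be the Lie algebra over ℂ presented by generators e_i, f_i, h_i (i∈I) and the Serre relations associated to A, and let σ be an admissible diagram automorphism of A, acting on 𝔤 by e_i ↦ e_{σ(i)}, f_i ↦ f_{σ(i)}, h_i ↦ h_{σ(i)}. Let A' = (a'_{rs})_{r,s∈I/σ} be the folded Cartan matrix, a'_{rs} = Σ_{i∈O_r} a_{ij} for any j∈O_s, and let 𝔤' be the Lie algebra presented by generators e'_r, f'_r, h'_r and the Serre relations associated to A'. Then the assignment e'_r ↦ Σ_{i∈O_r} e_i, f'_r ↦ Σ_{i∈O_r} f_i, h'_r ↦ Σ_{i∈O_r} h_i extends to a Lie algebra isomorphism from 𝔤' onto the fixed-point subalgebra 𝔤^σ = {x ∈ 𝔤 : σ(x) = x}. -/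
open scoped Classical

noncomputable section

/-- The σ-orbit of `i`, as a `Finset`. -/
def sigmaOrbit {I : Type*} [Fintype I] (σ : Equiv.Perm I) (i : I) : Finset I :=
  Finset.univ.filter (fun x => ∃ k : ℤ, (σ ^ k) i = x)

/-- The Chevalley–Serre generators `e_i, f_i, h_i` indexed by `I`. -/
inductive SGen (I : Type*)
  | e (i : I)
  | f (i : I)
  | h (i : I)

variable {I : Type*}

/-- The generator `e_i` of the free Lie algebra. -/
def ge (i : I) : FreeLieAlgebra ℂ (SGen I) := FreeLieAlgebra.of ℂ (SGen.e i)
/-- The generator `f_i` of the free Lie algebra. -/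
def gf (i : I) : FreeLieAlgebra ℂ (SGen I) := FreeLieAlgebra.of ℂ (SGen.f i)
/-- The generator `h_i` of the free Lie algebra. -/
def gh (i : I) : FreeLieAlgebra ℂ (SGen I) := FreeLieAlgebra.of ℂ (SGen.h i)

/-- Iterated adjoint action `(ad x)^k y` in a Lie algebra. -/
def adPow {L : Type*} [LieRing L] (x : L) (k : ℕ) (y : L) : L :=
  (fun z => ⁅x, z⁆)^[k] y

/-- The Serre relations associated to a (generalized) Cartan matrix `B`. -/
inductive SerreRel (B : I → I → ℤ) : FreeLieAlgebra ℂ (SGen I) → Prop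
  | hh (i j : I) : SerreRel B ⁅gh i, gh j⁆
  | ef (i j : I) : SerreRel B (⁅ge i, gf j⁆ - if i = j then gh i else 0)
  | he (i j : I) : SerreRel B (⁅gh i, ge j⁆ - (B i j : ℂ) • ge j)
  | hf (i j : I) : SerreRel B (⁅gh i, gf j⁆ + (B i j : ℂ) • gf j)
  | ade (i j : I) : i ≠ j → SerreRel B (adPow (ge i) (1 - B i j).toNat (ge j))
  | adf (i j : I) : i ≠ j → SerreRel B (adPow (gf i) (1 - B i j).toNat (gf j))

/-- The Lie algebra presented by the Serre relations of `B`. -/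
abbrev SerreAlgebra (B : I → I → ℤ) :=
  FreeLieAlgebra ℂ (SGen I) ⧸
    LieSubmodule.lieSpan ℂ (FreeLieAlgebra ℂ (SGen I)) { x | SerreRel B x }

/-- The canonical image of a generator in the presented Lie algebra. -/
def sMk (B : I → I → ℤ) (x : FreeLieAlgebra ℂ (SGen I)) : SerreAlgebra B :=
  LieSubmodule.Quotient.mk (N := LieSubmodule.lieSpan ℂ (FreeLieAlgebra ℂ (SGen I))
    { x | SerreRel B x }) x


/-! ### Weight vectors and the rank-one argument -/

section Weights

variable {R M : Type*} [Fintype R] [AddCommGroup M] [Module ℂ M]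

/-- The pairing of the weight `β` with the `r`-th coroot. -/
def pair (B : R → R → ℤ) (β : R → ℤ) (r : R) : ℤ := ∑ s, B r s * β s

/-- `v` is a weight vector of weight `β`. -/
def HasWt (H : R → M →ₗ[ℂ] M) (B : R → R → ℤ) (β : R → ℤ) (v : M) : Prop :=
  ∀ r, H r v = ((pair B β r : ℤ) : ℂ) • v

lemma pair_add (B : R → R → ℤ) (β γ : R → ℤ) (r : R) :
    pair B (β + γ) r = pair B β r + pair B γ r := by
  simp [pair, mul_add, Finset.sum_add_distrib]

lemma pair_neg (B : R → R → ℤ) (β : R → ℤ) (r : R) :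
    pair B (-β) r = - pair B β r := by
  simp [pair]

lemma pair_sub (B : R → R → ℤ) (β γ : R → ℤ) (r : R) :
    pair B (β - γ) r = pair B β r - pair B γ r := by
  rw [sub_eq_add_neg, pair_add, pair_neg, sub_eq_add_neg]

lemma pair_single (B : R → R → ℤ) (s : R) (r : R) :
    pair B (Pi.single s 1) r = B r s := by
  simp [pair, Pi.single_apply]

lemma HasWt.zero (H : R → M →ₗ[ℂ] M) (B : R → R → ℤ) (β : R → ℤ) : HasWt H B β 0 := by
  intro r; simp

/-- Rank-one lemma. -/
lemma sl2_step (E F H : M →ₗ[ℂ] M)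
    (hEF : ∀ v, E (F v) = F (E v) + H v)
    (hHE : ∀ v, H (E v) = E (H v) + (2 : ℂ) • E v)
    (hHF : ∀ v, H (F v) = F (H v) - (2 : ℂ) • F v)
    (U : Submodule ℂ M) (hUE : ∀ v ∈ U, E v ∈ U) (hUF : ∀ v ∈ U, F v ∈ U)
    (v : M) (hv : v ∉ U) (m : ℕ) (hm : H v = (m : ℂ) • v)
    (hN : ∃ N : ℕ, (E ^ N) v ∈ U) :
    ∃ N : ℕ, (F ^ (m + N)) ((E ^ N) v) ∉ U := by
  have hex := Nat.find_spec hN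
  have hpos : Nat.find hN ≠ 0 := by
    intro h0; rw [h0] at hex; exact hv (by simpa using hex)
  obtain ⟨N, hNN⟩ := Nat.exists_eq_succ_of_ne_zero hpos
  have hu : (E ^ N) v ∉ U := Nat.find_min hN (by omega)
  have hEu : E ((E ^ N) v) ∈ U := by
    rw [hNN] at hex
    simpa [pow_succ'] using hex
  have hwE : ∀ k : ℕ, H ((E ^ k) v) = ((m : ℂ) + 2 * k) • (E ^ k) v := by
    intro k
    induction k with
    | zero => simpa using hm
    | succ k ih =>
      rw [pow_succ', Module.End.mul_apply, hHE, ih, map_smul, ← add_smul]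
      congr 1; push_cast; ring
  set u := (E ^ N) v with hudef
  have hHu : H u = ((m : ℂ) + 2 * N) • u := hwE N
  have hwF : ∀ k : ℕ, H ((F ^ k) u) = ((m : ℂ) + 2 * N - 2 * k) • (F ^ k) u := by
    intro k
    induction k with
    | zero => simpa using hHu
    | succ k ih =>
      rw [pow_succ', Module.End.mul_apply, hHF, ih, map_smul, ← sub_smul]
      congr 1; push_cast; ring
  have hEFk : ∀ k : ℕ, E ((F ^ (k+1)) u) - (((k:ℂ)+1) * ((m:ℂ) + 2 * N - k)) • (F ^ k) u ∈ U := by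
    intro k
    induction k with
    | zero =>
      simp only [zero_add, pow_one, pow_zero, Module.End.one_apply]
      rw [hEF, hHu]
      have := hUF _ hEu
      convert this using 1
      simp
    | succ k ih =>
      rw [pow_succ' F (k+1), Module.End.mul_apply, hEF, hwF]
      have := hUF _ ih
      convert this using 1
      rw [map_sub, map_smul, pow_succ' F k, Module.End.mul_apply]
      rw [sub_eq_sub_iff_add_eq_add, add_assoc, ← add_smul]
      rw [← sub_eq_zero, add_sub_add_left_eq_sub, ← sub_smul]
      convert zero_smul ℂ _
      push_cast; ring
  have hall : ∀ k : ℕ, k ≤ m + 2 * N → (F ^ k) u ∉ U := by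
    intro k
    induction k with
    | zero => intro _; simpa using hu
    | succ k ih =>
      intro hk hmem
      apply ih (by omega)
      have h1 := hEFk k
      have h2 : (((k:ℂ)+1) * ((m:ℂ) + 2 * N - k)) • (F ^ k) u ∈ U := by
        have := U.sub_mem (hUE _ hmem) h1
        simpa using this
      refine (Submodule.smul_mem_iff U ?_).1 h2
      have h3 : ((k:ℂ)+1) ≠ 0 := by exact_mod_cast Nat.succ_ne_zero k
      have h4 : ((m:ℂ) + 2 * N - k) ≠ 0 := by
        rw [sub_ne_zero]
        have : m + 2 * N ≠ k := by omega
        exact_mod_cast this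
      exact mul_ne_zero h3 h4
  exact ⟨N, hall _ (by omega)⟩

/-- Induction on the height: a relative weight module without weight vectors of weight a multiple of
a simple root has no nonnegative weights. -/
lemma pos_weights (B : R → R → ℤ)
    (hBpos : ∀ β : R → ℤ, 0 ≤ β → β ≠ 0 → ∃ r, 0 < pair B β r)
    (hB2 : ∀ r, B r r = 2)
    (E F H : R → M →ₗ[ℂ] M)
    (hEF : ∀ r v, E r (F r v) = F r (E r v) + H r v)
    (hHE : ∀ s r v, H s (E r v) = E r (H s v) + ((B s r : ℤ) : ℂ) • E r v)
    (hHF : ∀ s r v, H s (F r v) = F r (H s v) - ((B s r : ℤ) : ℂ) • F r v)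
    (U V : Submodule ℂ M) (hUE : ∀ r, ∀ v ∈ U, E r v ∈ U) (hUF : ∀ r, ∀ v ∈ U, F r v ∈ U)
    (hVE : ∀ r, ∀ v ∈ V, E r v ∈ V) (hVF : ∀ r, ∀ v ∈ V, F r v ∈ V)
    (hnil : ∀ r, ∀ v ∈ V, ∃ N : ℕ, ((E r) ^ N) v ∈ U)
    (hQ : ∀ β, ∀ v ∈ V, HasWt H B β v → v ∉ U → 0 ≤ β ∨ β ≤ 0)
    (hbase0 : ∀ v ∈ V, HasWt H B 0 v → v ∈ U)
    (hbase : ∀ (r : R) (k : ℕ), ∀ v ∈ V, HasWt H B ((k : ℤ) • Pi.single r 1) v → v ∈ U) :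
    ∀ β : R → ℤ, 0 ≤ β → ∀ v ∈ V, HasWt H B β v → v ∈ U := by
  suffices h : ∀ n : ℕ, ∀ β : R → ℤ, 0 ≤ β → (∑ r, β r) ≤ n → ∀ v ∈ V, HasWt H B β v → v ∈ U by
    intro β hβ
    exact h (∑ r, β r).toNat β hβ (Int.self_le_toNat _)
  have hwE : ∀ r β v, HasWt H B β v → HasWt H B (β + Pi.single r 1) (E r v) := by
    intro r β v hv s
    rw [hHE, hv s, map_smul, ← add_smul, pair_add, pair_single]
    push_cast; rfl
  have hwF : ∀ r β v, HasWt H B β v → HasWt H B (β - Pi.single r 1) (F r v) := by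
    intro r β v hv s
    rw [hHF, hv s, map_smul, ← sub_smul, pair_sub, pair_single]
    push_cast; rfl
  have hwE' : ∀ r β v (k : ℕ), HasWt H B β v →
      HasWt H B (β + (k : ℤ) • Pi.single r 1) ((E r ^ k) v) := by
    intro r β v k hv
    induction k with
    | zero => simpa using hv
    | succ k ih =>
      rw [pow_succ', Module.End.mul_apply]
      convert hwE r _ _ ih using 1
      push_cast; rw [add_smul, one_smul]; abel
  have hwF' : ∀ r β v (k : ℕ), HasWt H B β v →
      HasWt H B (β - (k : ℤ) • Pi.single r 1) ((F r ^ k) v) := by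
    intro r β v k hv
    induction k with
    | zero => simpa using hv
    | succ k ih =>
      rw [pow_succ', Module.End.mul_apply]
      convert hwF r _ _ ih using 1
      push_cast; rw [add_smul, one_smul]; abel
  have hVE' : ∀ r v (k : ℕ), v ∈ V → (E r ^ k) v ∈ V := by
    intro r v k hv
    induction k with
    | zero => simpa using hv
    | succ k ih => rw [pow_succ', Module.End.mul_apply]; exact hVE r _ ih
  have hVF' : ∀ r v (k : ℕ), v ∈ V → (F r ^ k) v ∈ V := by
    intro r v k hv
    induction k with
    | zero => simpa using hv
    | succ k ih => rw [pow_succ', Module.End.mul_apply]; exact hVF r _ ih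
  intro n
  induction n with
  | zero =>
    intro β hβ hs v hv hw
    have hβ0 : β = 0 := by
      have h0 : ∑ r, β r = 0 := le_antisymm (by simpa using hs) (Finset.sum_nonneg fun r _ => hβ r)
      ext r
      exact (Finset.sum_eq_zero_iff_of_nonneg (fun r _ => hβ r)).1 h0 r (Finset.mem_univ r)
    exact hbase0 v hv (by simpa [hβ0] using hw)
  | succ n ih =>
    intro β hβ hs v hv hw
    by_contra hvU
    by_cases hβ0 : β = 0
    · subst hβ0
      exact hvU (hbase0 v hv hw)
    obtain ⟨r, hr⟩ := hBpos β hβ hβ0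
    by_cases hmul : ∀ s, s ≠ r → β s = 0
    · apply hvU
      apply hbase r (β r).toNat v hv
      convert hw using 1
      ext s
      by_cases hsr : s = r
      · subst hsr; simpa using hβ s
      · simp [hsr, hmul s hsr]
    push Not at hmul
    obtain ⟨s, hsr, hs0⟩ := hmul
    obtain ⟨m, hm⟩ := Int.eq_ofNat_of_zero_le hr.le
    obtain ⟨N, hN⟩ := sl2_step (E r) (F r) (H r) (hEF r)
      (by intro v; rw [hHE, hB2]; norm_num) (by intro v; rw [hHF, hB2]; norm_num)
      U (hUE r) (hUF r) v hvU m (by rw [hw r, hm]; simp) (hnil r v hv)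
    have hwt : HasWt H B (β - (m : ℤ) • Pi.single r 1) ((F r ^ (m + N)) ((E r ^ N) v)) := by
      convert hwF' r _ _ (m + N) (hwE' r _ _ N hw) using 1
      push_cast; rw [add_smul]; abel
    have hmemV := hVF' r _ (m + N) (hVE' r _ N hv)
    have hge : 0 ≤ β - (m : ℤ) • Pi.single r 1 := by
      rcases hQ _ _ hmemV hwt hN with h | h
      · exact h
      · exfalso
        have := h s
        simp [hsr] at this
        exact hs0 (le_antisymm this (hβ s))
    refine hN (ih _ hge ?_ _ hmemV hwt)
    have : ∑ x, (β - (m : ℤ) • (Pi.single r 1 : R → ℤ)) x = ∑ x, β x - m := by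
      simp [Finset.sum_sub_distrib, Pi.single_apply]
    rw [this]
    push_cast at hs
    omega

end Weights

section Weights2

variable {R M : Type*} [Fintype R] [AddCommGroup M] [Module ℂ M]

lemma hasWt_neg (H : R → M →ₗ[ℂ] M) (B : R → R → ℤ) (β : R → ℤ) (v : M) :
    HasWt (fun r => -(H r)) B β v ↔ HasWt H B (-β) v := by
  unfold HasWt
  refine forall_congr' fun r => ?_
  rw [pair_neg, LinearMap.neg_apply]
  push_cast
  rw [neg_smul, neg_eq_iff_eq_neg]

/-- Both signs at once. -/
lemma all_weights (B : R → R → ℤ)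
    (hBpos : ∀ β : R → ℤ, 0 ≤ β → β ≠ 0 → ∃ r, 0 < pair B β r)
    (hB2 : ∀ r, B r r = 2)
    (E F H : R → M →ₗ[ℂ] M)
    (hEF : ∀ r v, E r (F r v) = F r (E r v) + H r v)
    (hHE : ∀ s r v, H s (E r v) = E r (H s v) + ((B s r : ℤ) : ℂ) • E r v)
    (hHF : ∀ s r v, H s (F r v) = F r (H s v) - ((B s r : ℤ) : ℂ) • F r v)
    (U V : Submodule ℂ M) (hUE : ∀ r, ∀ v ∈ U, E r v ∈ U) (hUF : ∀ r, ∀ v ∈ U, F r v ∈ U)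
    (hVE : ∀ r, ∀ v ∈ V, E r v ∈ V) (hVF : ∀ r, ∀ v ∈ V, F r v ∈ V)
    (hnilE : ∀ r, ∀ v ∈ V, ∃ N : ℕ, ((E r) ^ N) v ∈ U)
    (hnilF : ∀ r, ∀ v ∈ V, ∃ N : ℕ, ((F r) ^ N) v ∈ U)
    (hQ : ∀ β, ∀ v ∈ V, HasWt H B β v → v ∉ U → 0 ≤ β ∨ β ≤ 0)
    (hbase0 : ∀ v ∈ V, HasWt H B 0 v → v ∈ U)
    (hbase : ∀ (r : R) (k : ℕ), 0 < k →
      ∀ v ∈ V, HasWt H B ((k : ℤ) • Pi.single r 1) v → v ∈ U)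
    (hbase' : ∀ (r : R) (k : ℕ), 0 < k →
      ∀ v ∈ V, HasWt H B (-((k : ℤ) • Pi.single r 1)) v → v ∈ U)
    (hspan : V ≤ Submodule.span ℂ {v | v ∈ V ∧ ∃ β, HasWt H B β v}) :
    V ≤ U := by
  refine hspan.trans (Submodule.span_le.2 ?_)
  rintro v ⟨hv, β, hw⟩
  by_contra hvU
  rcases hQ β v hv hw hvU with h | h
  · refine hvU (pos_weights B hBpos hB2 E F H hEF hHE hHF U V hUE hUF hVE hVF hnilE hQ hbase0 ?_
      β h v hv hw)
    intro r k w hwV hww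
    rcases Nat.eq_zero_or_pos k with rfl | hk
    · exact hbase0 w hwV (by simpa using hww)
    · exact hbase r k hk w hwV hww
  · refine hvU (pos_weights B hBpos hB2 F E (fun r => -(H r)) ?_ ?_ ?_ U V hUF hUE hVF hVE hnilF
      ?_ ?_ ?_ (-β) (by simpa using h) v hv (by rw [hasWt_neg]; simpa using hw))
    · intro r v; rw [hEF]; simp
    · intro s r v; simp [hHF]; abel
    · intro s r v; simp [hHE]; abel
    · intro γ w hwV hww hwU
      rw [hasWt_neg] at hww
      rcases hQ _ w hwV hww hwU with h | h
      · right; simpa using h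
      · left; simpa using h
    · intro w hwV hww
      rw [hasWt_neg] at hww
      exact hbase0 w hwV (by simpa using hww)
    · intro r k w hwV hww
      rw [hasWt_neg] at hww
      rcases Nat.eq_zero_or_pos k with rfl | hk
      · exact hbase0 w hwV (by simpa using hww)
      · exact hbase' r k hk w hwV hww

lemma component_mem (B : R → R → ℤ)
    (hinj : ∀ β γ : R → ℤ, pair B β = pair B γ → β = γ)
    (H : R → M →ₗ[ℂ] M) (V : Submodule ℂ M) (hV : ∀ r, ∀ v ∈ V, H r v ∈ V)
    (β : R → ℤ) (s : Finset (R → ℤ)) (hs : β ∉ s) :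
    ∀ (x : M) (y : (R → ℤ) → M), HasWt H B β x → (∀ γ, HasWt H B γ (y γ)) →
      x + ∑ γ ∈ s, y γ ∈ V → x ∈ V := by
  induction s using Finset.induction_on with
  | empty => intro x y _ _ h; simpa using h
  | insert γ s hγ ih =>
    intro x y hx hy h
    rw [Finset.mem_insert, not_or] at hs
    have hne : pair B β ≠ pair B γ := fun h => hs.1 (hinj _ _ h)
    obtain ⟨r, hr⟩ := Function.ne_iff.1 hne
    have h1 := V.sub_mem (hV r _ h) (V.smul_mem ((pair B γ r : ℤ) : ℂ) h)
    have hc : (((pair B β r : ℤ) : ℂ) - ((pair B γ r : ℤ) : ℂ)) ≠ 0 := by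
      rw [sub_ne_zero]; exact_mod_cast hr
    refine (Submodule.smul_mem_iff V hc).1 ?_
    refine ih hs.2 _ (fun δ => (((pair B δ r : ℤ) : ℂ) - ((pair B γ r : ℤ) : ℂ)) • y δ) ?_ ?_ ?_
    · intro t; rw [map_smul, hx t, smul_comm]
    · intro δ t; rw [map_smul, hy δ t, smul_comm]
    · convert h1 using 1
      rw [Finset.sum_insert hγ, map_add, map_add, map_sum, hx r, hy γ r]
      simp only [smul_add, Finset.smul_sum]
      rw [Finset.sum_congr rfl (fun δ _ => hy δ r)]
      simp only [sub_smul, Finset.sum_sub_distrib]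
      abel

lemma exists_decomp {κ : Type*} (B : R → R → ℤ) (H : R → M →ₗ[ℂ] M)
    (S : κ → M) (wt : κ → R → ℤ) (hS : ∀ k, HasWt H B (wt k) (S k))
    (x : M) (hx : x ∈ Submodule.span ℂ (Set.range S)) :
    ∃ y : (R → ℤ) →₀ M, (∀ β, y β ∈ Submodule.span ℂ (S '' {k | wt k = β})) ∧
      (∀ β, HasWt H B β (y β)) ∧ y.sum (fun _ v => v) = x := by
  have : x ∈ ⨆ β, Submodule.span ℂ (S '' {k | wt k = β}) := by
    rw [← Submodule.span_iUnion]
    refine Submodule.span_mono ?_ hx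
    rintro _ ⟨k, rfl⟩
    exact Set.mem_iUnion.2 ⟨wt k, k, rfl, rfl⟩
  obtain ⟨y, hy, hsum⟩ := (Submodule.mem_iSup_iff_exists_finsupp _ _).1 this
  refine ⟨y, hy, ?_, hsum⟩
  intro β r
  have hle : Submodule.span ℂ (S '' {k | wt k = β}) ≤
      LinearMap.ker (H r - ((pair B β r : ℤ) : ℂ) • LinearMap.id) := by
    rw [Submodule.span_le]
    rintro _ ⟨k, rfl, rfl⟩
    simp [hS k r]
  have := hle (hy β)
  rw [LinearMap.mem_ker] at this
  simpa [sub_eq_zero] using this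

lemma mem_span_of_wt {κ : Type*} (B : R → R → ℤ)
    (hinj : ∀ β γ : R → ℤ, pair B β = pair B γ → β = γ) (H : R → M →ₗ[ℂ] M)
    (S : κ → M) (wt : κ → R → ℤ) (hS : ∀ k, HasWt H B (wt k) (S k))
    (x : M) (hx : x ∈ Submodule.span ℂ (Set.range S)) (β : R → ℤ) (hw : HasWt H B β x) :
    x ∈ Submodule.span ℂ (S '' {k | wt k = β}) := by
  obtain ⟨y, hy, hyw, hsum⟩ := exists_decomp B H S wt hS x hx
  have key := component_mem B hinj H ⊥ (by simp) β (y.support.erase β) (by simp)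
    (y β - x) y (by intro r; rw [map_sub, hyw β r, hw r, smul_sub]) hyw ?_
  · rw [Submodule.mem_bot, sub_eq_zero] at key
    rw [← key]; exact hy β
  · rw [Submodule.mem_bot]
    have h2 : y.sum (fun _ v => v) = y β + ∑ γ ∈ y.support.erase β, y γ := by
      by_cases hβ : β ∈ y.support
      · rw [Finsupp.sum, ← Finset.add_sum_erase _ _ hβ]
      · rw [Finset.erase_eq_of_notMem hβ, Finsupp.notMem_support_iff.1 hβ, zero_add]; rfl
    rw [← hsum, h2]; abel

lemma stable_span {κ : Type*} (B : R → R → ℤ)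
    (hinj : ∀ β γ : R → ℤ, pair B β = pair B γ → β = γ) (H : R → M →ₗ[ℂ] M)
    (S : κ → M) (wt : κ → R → ℤ) (hS : ∀ k, HasWt H B (wt k) (S k))
    (hspan : Submodule.span ℂ (Set.range S) = ⊤)
    (V : Submodule ℂ M) (hV : ∀ r, ∀ v ∈ V, H r v ∈ V) :
    V ≤ Submodule.span ℂ {v | v ∈ V ∧ ∃ β, HasWt H B β v} := by
  intro x hx
  obtain ⟨y, hy, hyw, hsum⟩ := exists_decomp B H S wt hS x (hspan ▸ Submodule.mem_top)
  rw [← hsum]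
  refine Submodule.sum_mem _ fun β hβ => Submodule.subset_span ⟨?_, β, hyw β⟩
  refine component_mem B hinj H V hV β (y.support.erase β) (by simp) (y β) y (hyw β) hyw ?_
  rw [Finset.add_sum_erase _ _ hβ]
  have : ∑ γ ∈ y.support, y γ = x := hsum
  rwa [this]

end Weights2

/-! ### Words in the generators -/

section Words

/-- Right-normed brackets. -/
def word {L ι : Type*} [LieRing L] (e : ι → L) : List ι → L
  | [] => 0
  | [i] => e i
  | i :: j :: l => ⁅e i, word e (j :: l)⁆

/-- Weight of a word, after relabelling by `p`. -/
def wtw {R ι : Type*} (p : ι → R) : List ι → R → ℤ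
  | [] => 0
  | i :: l => Pi.single (p i) 1 + wtw p l

variable {L ι : Type*} [LieRing L] [LieAlgebra ℂ L]

/-- Chevalley type generators (no Serre relations). -/
structure Chev (B : ι → ι → ℤ) (e f h : ι → L) : Prop where
  hh : ∀ i j, ⁅h i, h j⁆ = 0
  ef : ∀ i j, ⁅e i, f j⁆ = if i = j then h i else 0
  he : ∀ i j, ⁅h i, e j⁆ = ((B i j : ℤ) : ℂ) • e j
  hf : ∀ i j, ⁅h i, f j⁆ = - (((B i j : ℤ) : ℂ) • f j)
  gen : ∀ K : LieSubalgebra ℂ L, (∀ i, e i ∈ K) → (∀ i, f i ∈ K) → (∀ i, h i ∈ K) → K = ⊤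

lemma Chev.swap {B : ι → ι → ℤ} {e f h : ι → L} (c : Chev B e f h) :
    Chev B f e (fun i => - h i) where
  hh i j := by simp [c.hh]
  ef i j := by
    rw [← lie_skew, c.ef]
    by_cases hij : i = j
    · subst hij; simp
    · simp [hij, Ne.symm hij]
  he i j := by simp [c.hf]
  hf i j := by simp [c.he]
  gen K h1 h2 h3 := c.gen K h2 h1 (fun i => by simpa using h3 i)

lemma e_word_mem (e : ι → L) (i : ι) (l : List ι) :
    ⁅e i, word e l⁆ ∈ Submodule.span ℂ (Set.range (word e)) := by
  cases l with
  | nil => simp [word]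
  | cons j l => exact Submodule.subset_span ⟨i :: j :: l, rfl⟩

lemma h_word {B : ι → ι → ℤ} {e f h : ι → L} (c : Chev B e f h) (i : ι) (l : List ι) :
    ∃ a : ℂ, ⁅h i, word e l⁆ = a • word e l := by
  induction l with
  | nil => exact ⟨0, by simp [word]⟩
  | cons j l ih =>
    cases l with
    | nil => exact ⟨_, c.he i j⟩
    | cons k l =>
      obtain ⟨a, ha⟩ := ih
      refine ⟨((B i j : ℤ) : ℂ) + a, ?_⟩
      rw [word, leibniz_lie, ha, c.he, add_smul, smul_lie, lie_smul]

/-- e-words and h -/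
def wordH (e h : ι → L) : Submodule ℂ L := Submodule.span ℂ (Set.range (word e) ∪ Set.range h)

lemma e_wordH {B : ι → ι → ℤ} {e f h : ι → L} (c : Chev B e f h) (i : ι) (x : L)
    (hx : x ∈ wordH e h) : ⁅e i, x⁆ ∈ wordH e h := by
  have : wordH e h ≤ (wordH e h).comap (LieAlgebra.ad ℂ L (e i)) := by
    refine Submodule.span_le.2 ?_
    rintro _ (⟨l, rfl⟩ | ⟨j, rfl⟩)
    · exact Submodule.span_mono Set.subset_union_left (e_word_mem e i l)
    · show ⁅e i, h j⁆ ∈ wordH e h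
      rw [← lie_skew, c.he]
      exact Submodule.neg_mem _ (Submodule.smul_mem _ _ (Submodule.subset_span (Or.inl ⟨[i], rfl⟩)))
  exact this hx

lemma f_word {B : ι → ι → ℤ} {e f h : ι → L} (c : Chev B e f h) (i : ι) (l : List ι) :
    ⁅f i, word e l⁆ ∈ wordH e h := by
  induction l with
  | nil => simp [word]
  | cons j l ih =>
    have hfe : ⁅f i, e j⁆ = if j = i then - h j else 0 := by
      rw [← lie_skew, c.ef]; split_ifs <;> simp
    cases l with
    | nil =>
      rw [word, hfe]
      split_ifs
      · exact Submodule.neg_mem _ (Submodule.subset_span (Or.inr ⟨j, rfl⟩))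
      · exact Submodule.zero_mem _
    | cons k l =>
      rw [word, leibniz_lie, hfe]
      refine Submodule.add_mem _ ?_ (e_wordH c j _ ih)
      split_ifs
      · obtain ⟨a, ha⟩ := h_word c j (k :: l)
        rw [neg_lie, ha]
        exact Submodule.neg_mem _ (Submodule.smul_mem _ _ (Submodule.subset_span (Or.inl ⟨_, rfl⟩)))
      · simp

/-- The spanning family. -/
def famS (e f h : ι → L) : List ι ⊕ ι ⊕ List ι → L
  | .inl l => word e l
  | .inr (.inl i) => h i
  | .inr (.inr l) => word f l

/-- its weights -/
def famW {R : Type*} (p : ι → R) : List ι ⊕ ι ⊕ List ι → R → ℤ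
  | .inl l => wtw p l
  | .inr (.inl _) => 0
  | .inr (.inr l) => - wtw p l

lemma wordH_le (e f h : ι → L) : wordH e h ≤ Submodule.span ℂ (Set.range (famS e f h)) := by
  refine Submodule.span_mono ?_
  rintro _ (⟨l, rfl⟩ | ⟨j, rfl⟩)
  · exact ⟨.inl l, rfl⟩
  · exact ⟨.inr (.inl j), rfl⟩

lemma wordH_le' (e f h : ι → L) :
    wordH f (fun i => - h i) ≤ Submodule.span ℂ (Set.range (famS e f h)) := by
  refine Submodule.span_le.2 ?_
  rintro _ (⟨l, rfl⟩ | ⟨j, rfl⟩)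
  · exact Submodule.subset_span ⟨.inr (.inr l), rfl⟩
  · exact Submodule.neg_mem _ (Submodule.subset_span ⟨.inr (.inl j), rfl⟩)

/-- Stabilizer of a submodule. -/
def stab (T : Submodule ℂ L) : LieSubalgebra ℂ L where
  carrier := {x | ∀ t ∈ T, ⁅x, t⁆ ∈ T}
  add_mem' ha hb t ht := by rw [add_lie]; exact T.add_mem (ha t ht) (hb t ht)
  zero_mem' t _ := by simp
  smul_mem' a x hx t ht := by rw [smul_lie]; exact T.smul_mem a (hx t ht)
  lie_mem' {x y} hx hy t ht := by
    rw [lie_lie]; exact T.sub_mem (hx _ (hy t ht)) (hy _ (hx t ht))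

lemma mem_stab_span {x : L} {s : Set L} (h : ∀ y ∈ s, ⁅x, y⁆ ∈ Submodule.span ℂ s) :
    x ∈ stab (Submodule.span ℂ s) := by
  have : Submodule.span ℂ s ≤ (Submodule.span ℂ s).comap (LieAlgebra.ad ℂ L x) :=
    Submodule.span_le.2 h
  exact fun t ht => this ht

lemma famS_span {B : ι → ι → ℤ} {e f h : ι → L} (c : Chev B e f h) :
    Submodule.span ℂ (Set.range (famS e f h)) = ⊤ := by
  set T := Submodule.span ℂ (Set.range (famS e f h)) with hT
  have hinl : ∀ l, word e l ∈ T := fun l => Submodule.subset_span ⟨.inl l, rfl⟩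
  have hinh : ∀ l, h l ∈ T := fun l => Submodule.subset_span ⟨.inr (.inl l), rfl⟩
  have hinr : ∀ l, word f l ∈ T := fun l => Submodule.subset_span ⟨.inr (.inr l), rfl⟩
  have hstab : stab T = ⊤ := by
    apply c.gen
    · intro i
      apply mem_stab_span
      rintro _ ⟨l | j | l, rfl⟩
      · exact wordH_le e f h (e_wordH c i _ (Submodule.subset_span (Or.inl ⟨l, rfl⟩)))
      · exact wordH_le e f h (e_wordH c i _ (Submodule.subset_span (Or.inr ⟨j, rfl⟩)))
      · exact wordH_le' e f h (f_word c.swap i l)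
    · intro i
      apply mem_stab_span
      rintro _ ⟨l | j | l, rfl⟩
      · exact wordH_le e f h (f_word c i l)
      · have := wordH_le' e f h (e_wordH c.swap i _ (Submodule.subset_span (Or.inr ⟨j, rfl⟩)))
        rw [lie_neg] at this
        exact (Submodule.neg_mem_iff _).1 this
      · exact wordH_le' e f h (e_wordH c.swap i _ (Submodule.subset_span (Or.inl ⟨l, rfl⟩)))
    · intro i
      apply mem_stab_span
      rintro _ ⟨l | j | l, rfl⟩
      · obtain ⟨a, ha⟩ := h_word c i l
        simp only [famS]
        rw [ha]; exact T.smul_mem _ (hinl l)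
      · simp [famS, c.hh]
      · obtain ⟨a, ha⟩ := h_word c.swap i l
        simp only [famS]
        rw [neg_lie, neg_eq_iff_eq_neg] at ha
        rw [ha]; exact T.neg_mem (T.smul_mem _ (hinr l))
  let K : LieSubalgebra ℂ L := { T with
    lie_mem' := fun {x y} _ hy => (hstab ▸ LieSubalgebra.mem_top x : x ∈ stab T) y hy }
  have hK : K = ⊤ := c.gen K (fun i => hinl [i]) (fun i => hinr [i]) hinh
  rw [eq_top_iff]
  intro x _
  have : x ∈ K := hK ▸ LieSubalgebra.mem_top x
  exact this

lemma word_wt {R : Type*} [Fintype R] (p : ι → R) (A' : R → R → ℤ) (H : R → L) (e : ι → L)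
    (hHe : ∀ r i, ⁅H r, e i⁆ = ((A' r (p i) : ℤ) : ℂ) • e i) (l : List ι) :
    HasWt (fun r => (LieAlgebra.ad ℂ L (H r) : L →ₗ[ℂ] L)) A' (wtw p l) (word e l) := by
  induction l with
  | nil => exact HasWt.zero _ _ _
  | cons j l ih =>
    intro r
    rw [wtw, pair_add, pair_single]
    cases l with
    | nil =>
      simp [word, wtw, hHe, pair]
    | cons k l =>
      have := ih r
      simp only [LieAlgebra.ad_apply] at this ⊢
      rw [word, leibniz_lie, this, hHe]
      push_cast
      rw [add_smul, smul_lie, lie_smul]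

lemma wtw_nonneg {R : Type*} (p : ι → R) (l : List ι) : 0 ≤ wtw p l := by
  induction l with
  | nil => exact le_rfl
  | cons i l ih => exact add_nonneg (by simp) ih

lemma wtw_pos {R : Type*} (p : ι → R) (l : List ι) (i : ι) (hi : i ∈ l) : 0 < wtw p l (p i) := by
  induction l with
  | nil => simp at hi
  | cons j l ih =>
    have h0 := wtw_nonneg p l (p i)
    have h1 : (0 : R → ℤ) ≤ Pi.single (p j) 1 := by simp
    have h1 := h1 (p i)
    simp only [Pi.zero_apply] at h0 h1
    rw [wtw, Pi.add_apply]
    rcases List.mem_cons.1 hi with rfl | hi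
    · simp; omega
    · have := ih hi; omega

lemma word_comm {R : Type*} (p : ι → R) (e : ι → L) (r : R)
    (hcomm : ∀ i j, p i = p j → ⁅e i, e j⁆ = 0) (l : List ι) (hl : ∀ i ∈ l, p i = r) :
    word e l ∈ Submodule.span ℂ (e '' {i | p i = r}) := by
  match l, hl with
  | [], _ => simp [word]
  | [i], hl => exact Submodule.subset_span ⟨i, hl i (by simp), rfl⟩
  | i :: j :: l, hl =>
    have key : ∀ m : List ι, (∀ k ∈ m, p k = r) → ∀ k k', p k = r → word e (k :: k' :: m) = 0 ∨
        p k' ≠ r := by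
      intro m
      induction m with
      | nil =>
        intro _ k k' hk
        by_cases hk' : p k' = r
        · left; exact hcomm k k' (hk.trans hk'.symm)
        · right; exact hk'
      | cons a m ih =>
        intro hm k k' hk
        by_cases hk' : p k' = r
        · left
          have := ih (fun b hb => hm b (by simp [hb])) k' a hk'
          rcases this with h | h
          · rw [word, h, lie_zero]
          · exact absurd (hm a (by simp)) h
        · right; exact hk'
    rcases key l (fun k hk => hl k (by simp [hk])) i j (hl i (by simp)) with h | h
    · rw [h]; exact Submodule.zero_mem _
    · exact absurd (hl j (by simp)) h

lemma fam_wt {R : Type*} [Fintype R] (p : ι → R) (A' : R → R → ℤ) (H : R → L) (e f h : ι → L)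
  (hHe : ∀ r i, ⁅H r, e i⁆ = ((A' r (p i) : ℤ) : ℂ) • e i)
  (hHf : ∀ r i, ⁅H r, f i⁆ = - (((A' r (p i) : ℤ) : ℂ) • f i))
  (hHh : ∀ r i, ⁅H r, h i⁆ = 0)
    (k : List ι ⊕ ι ⊕ List ι) :
    HasWt (fun r => (LieAlgebra.ad ℂ L (H r) : L →ₗ[ℂ] L)) A' (famW p k) (famS e f h k) := by
  rcases k with l | j | l
  · exact word_wt p A' H e hHe l
  · intro r; simp [famS, famW, hHh, pair]
  · have := word_wt p A' (fun r => - H r) f (by intro r i; rw [neg_lie, hHf, neg_neg]) l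
    simp only [map_neg] at this
    exact (hasWt_neg (fun r => (LieAlgebra.ad ℂ L (H r) : L →ₗ[ℂ] L)) _ _ _).1 this

end Words

section Structure

variable {L ι : Type*} [LieRing L] [LieAlgebra ℂ L] {R : Type*} [Fintype R]

lemma wt_mem {B : ι → ι → ℤ} {e f h : ι → L} (c : Chev B e f h)
    (p : ι → R) (A' : R → R → ℤ) (hinj : ∀ β γ : R → ℤ, pair A' β = pair A' γ → β = γ)
    (H : R → L)
    (hHe : ∀ r i, ⁅H r, e i⁆ = ((A' r (p i) : ℤ) : ℂ) • e i)
    (hHf : ∀ r i, ⁅H r, f i⁆ = - (((A' r (p i) : ℤ) : ℂ) • f i))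
    (hHh : ∀ r i, ⁅H r, h i⁆ = 0) (β : R → ℤ) (x : L)
    (hx : HasWt (fun r => (LieAlgebra.ad ℂ L (H r) : L →ₗ[ℂ] L)) A' β x) :
    x ∈ Submodule.span ℂ (famS e f h '' {k | famW p k = β}) :=
  mem_span_of_wt A' hinj _ (famS e f h) (famW p) (fam_wt p A' H e f h hHe hHf hHh) x
    (famS_span c ▸ Submodule.mem_top) β hx

lemma wt_sign {B : ι → ι → ℤ} {e f h : ι → L} (c : Chev B e f h)
    (p : ι → R) (A' : R → R → ℤ) (hinj : ∀ β γ : R → ℤ, pair A' β = pair A' γ → β = γ)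
    (H : R → L)
    (hHe : ∀ r i, ⁅H r, e i⁆ = ((A' r (p i) : ℤ) : ℂ) • e i)
    (hHf : ∀ r i, ⁅H r, f i⁆ = - (((A' r (p i) : ℤ) : ℂ) • f i))
    (hHh : ∀ r i, ⁅H r, h i⁆ = 0) (β : R → ℤ) (x : L)
    (hx : HasWt (fun r => (LieAlgebra.ad ℂ L (H r) : L →ₗ[ℂ] L)) A' β x) (hx0 : x ≠ 0) :
    0 ≤ β ∨ β ≤ 0 := by
  have hm := wt_mem c p A' hinj H hHe hHf hHh β x hx
  have hne : {k : List ι ⊕ ι ⊕ List ι | famW p k = β}.Nonempty := by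
    by_contra hemp
    rw [Set.not_nonempty_iff_eq_empty] at hemp
    rw [hemp] at hm
    exact hx0 (by simpa using hm)
  obtain ⟨k, rfl⟩ := hne
  rcases k with l | j | l
  · left; exact wtw_nonneg p l
  · left; exact le_rfl
  · right; simpa [famW] using wtw_nonneg p l

lemma wt_zero {B : ι → ι → ℤ} {e f h : ι → L} (c : Chev B e f h)
    (p : ι → R) (A' : R → R → ℤ) (hinj : ∀ β γ : R → ℤ, pair A' β = pair A' γ → β = γ)
    (H : R → L)
    (hHe : ∀ r i, ⁅H r, e i⁆ = ((A' r (p i) : ℤ) : ℂ) • e i)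
    (hHf : ∀ r i, ⁅H r, f i⁆ = - (((A' r (p i) : ℤ) : ℂ) • f i))
    (hHh : ∀ r i, ⁅H r, h i⁆ = 0) (x : L)
    (hx : HasWt (fun r => (LieAlgebra.ad ℂ L (H r) : L →ₗ[ℂ] L)) A' 0 x) :
    x ∈ Submodule.span ℂ (Set.range h) := by
  have hm := wt_mem c p A' hinj H hHe hHf hHh 0 x hx
  refine (Submodule.span_le.2 ?_ : _ ≤ Submodule.span ℂ (Set.range h)) hm
  have hnil : ∀ l : List ι, wtw p l = 0 → l = [] := by
    intro l hl
    cases l with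
    | nil => rfl
    | cons i l =>
      have := wtw_pos p (i :: l) i (by simp)
      rw [hl] at this; simp at this
  rintro _ ⟨l | j | l, hk, rfl⟩
  · rw [hnil l hk]; simp [famS, word]
  · exact Submodule.subset_span ⟨j, rfl⟩
  · rw [hnil l (by simpa [famW] using hk)]; simp [famS, word]

lemma wt_pos {B : ι → ι → ℤ} {e f h : ι → L} (c : Chev B e f h)
    (p : ι → R) (A' : R → R → ℤ) (hinj : ∀ β γ : R → ℤ, pair A' β = pair A' γ → β = γ)
    (H : R → L)
    (hHe : ∀ r i, ⁅H r, e i⁆ = ((A' r (p i) : ℤ) : ℂ) • e i)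
    (hHf : ∀ r i, ⁅H r, f i⁆ = - (((A' r (p i) : ℤ) : ℂ) • f i))
    (hHh : ∀ r i, ⁅H r, h i⁆ = 0)
    (hcomm : ∀ i j, p i = p j → ⁅e i, e j⁆ = 0) (r : R) (k : ℕ) (hk : 0 < k) (x : L)
    (hx : HasWt (fun r => (LieAlgebra.ad ℂ L (H r) : L →ₗ[ℂ] L)) A'
      ((k : ℤ) • Pi.single r 1) x) :
    x ∈ Submodule.span ℂ (e '' {i | p i = r}) := by
  have hm := wt_mem c p A' hinj H hHe hHf hHh _ x hx
  refine (Submodule.span_le.2 ?_ : _ ≤ Submodule.span ℂ (e '' {i | p i = r})) hm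
  rintro _ ⟨l | j | l, hl, rfl⟩
  · apply word_comm p e r hcomm
    intro i hi
    by_contra hne
    have h1 := wtw_pos p l i hi
    have h2 := congrFun hl (p i)
    simp only [famW] at h2
    rw [h2] at h1
    simp [hne] at h1
  · have h2 := congrFun hl r
    simp [famW] at h2; omega
  · have h2 := congrFun hl r
    have h1 := wtw_nonneg p l r
    simp [famW] at h1 h2; omega

lemma wt_neg {B : ι → ι → ℤ} {e f h : ι → L} (c : Chev B e f h)
    (p : ι → R) (A' : R → R → ℤ) (hinj : ∀ β γ : R → ℤ, pair A' β = pair A' γ → β = γ)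
    (H : R → L)
    (hHe : ∀ r i, ⁅H r, e i⁆ = ((A' r (p i) : ℤ) : ℂ) • e i)
    (hHf : ∀ r i, ⁅H r, f i⁆ = - (((A' r (p i) : ℤ) : ℂ) • f i))
    (hHh : ∀ r i, ⁅H r, h i⁆ = 0)
    (hcomm : ∀ i j, p i = p j → ⁅f i, f j⁆ = 0) (r : R) (k : ℕ) (hk : 0 < k) (x : L)
    (hx : HasWt (fun r => (LieAlgebra.ad ℂ L (H r) : L →ₗ[ℂ] L)) A'
      (-((k : ℤ) • Pi.single r 1)) x) :
    x ∈ Submodule.span ℂ (f '' {i | p i = r}) := by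
  refine wt_pos c.swap p A' hinj (fun r => - H r) ?_ ?_ ?_ hcomm r k hk x ?_
  · intro r i; rw [neg_lie, hHf, neg_neg]
  · intro r i; rw [neg_lie, hHe]
  · intro r i; simp [hHh]
  · simp only [map_neg]
    exact (hasWt_neg (fun r => (LieAlgebra.ad ℂ L (H r) : L →ₗ[ℂ] L)) _ _ _).2 hx

end Structure

/-! ### Positivity of the folded matrix -/

section Posdef

variable {I R : Type*} [Fintype I] [Fintype R]

lemma fold_pos (A : I → I → ℤ)
    (hposdef : Matrix.PosDef (Matrix.of fun i j : I => (A i j : ℝ)))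
    (π : I → R) (hπ : Function.Surjective π) (A' : R → R → ℤ)
    (hA' : ∀ r j, A' r (π j) = ∑ x ∈ Finset.univ.filter (fun x => π x = r), A x j)
    (β : R → ℤ) (hβ : β ≠ 0) :
    ∃ d : R → ℝ, (∀ r, 0 < d r) ∧ 0 < ∑ r, d r * β r * (pair A' β r : ℝ) := by
  let d : R → ℝ := fun r => 1 / ((Finset.univ.filter (fun x => π x = r)).card : ℝ)
  have hcard : ∀ r, 0 < ((Finset.univ.filter (fun x => π x = r)).card : ℝ) := by
    intro r
    obtain ⟨i, hi⟩ := hπ r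
    exact_mod_cast Finset.card_pos.2 ⟨i, by simp [hi]⟩
  have hd : ∀ r, 0 < d r := fun r => one_div_pos.2 (hcard r)
  refine ⟨d, hd, ?_⟩
  let x : I → ℝ := fun i => d (π i) * β (π i)
  have hx : x ≠ 0 := by
    intro h0
    apply hβ
    ext r
    obtain ⟨i, rfl⟩ := hπ r
    have := congrFun h0 i
    simp only [x, Pi.zero_apply, mul_eq_zero, (hd _).ne', false_or] at this
    exact_mod_cast this
  have hpos := hposdef.dotProduct_mulVec_pos hx
  have h1 : ∀ r, (pair A' β r : ℝ) =
      ∑ i ∈ Finset.univ.filter (fun i => π i = r), ∑ j, (A i j : ℝ) * x j := by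
    intro r
    rw [Finset.sum_comm, ]
    have h2 : ∀ j, ∑ i ∈ Finset.univ.filter (fun i => π i = r), (A i j : ℝ) * x j =
        (A' r (π j) : ℝ) * x j := by
      intro j; rw [← Finset.sum_mul, hA']; push_cast; rfl
    simp only [h2]
    rw [← Finset.sum_fiberwise Finset.univ π]
    simp only [pair]
    push_cast
    refine Finset.sum_congr rfl fun s _ => ?_
    rw [Finset.sum_congr rfl (g := fun _ => (A' r s : ℝ) * (d s * β s))]
    · rw [Finset.sum_const, nsmul_eq_mul]
      have := (hcard s).ne'
      simp only [d]; field_simp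
    · intro j hj
      simp only [Finset.mem_filter] at hj
      simp only [x, hj.2]
  have h3 : ∑ r, d r * β r * (pair A' β r : ℝ) = ∑ i, x i * ∑ j, (A i j : ℝ) * x j := by
    rw [← Finset.sum_fiberwise Finset.univ π]
    refine Finset.sum_congr rfl fun r _ => ?_
    rw [h1, Finset.mul_sum]
    refine Finset.sum_congr rfl fun i hi => ?_
    simp only [Finset.mem_filter] at hi
    simp only [x, hi.2]
  rw [h3]
  simpa [dotProduct, Matrix.mulVec] using hpos

end Posdef

/-! ### A module for the algebra without Serre relations -/

section Tensor

variable {I : Type*}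

/-- `F_i` -/
def TF (i : I) : (List I →₀ ℂ) →ₗ[ℂ] (List I →₀ ℂ) :=
  Finsupp.lmapDomain ℂ ℂ (fun l => i :: l)

/-- weights on words -/
def lw (A : I → I → ℤ) (i : I) : List I → ℤ
  | [] => 0
  | j :: l => A i j + lw A i l

/-- `H_i` -/
def TH (A : I → I → ℤ) (i : I) : (List I →₀ ℂ) →ₗ[ℂ] (List I →₀ ℂ) :=
  Finsupp.linearCombination ℂ (fun l => Finsupp.single l (-(lw A i l : ℤ) : ℂ))

/-- value of `E_i` on words -/
def evec (A : I → I → ℤ) (i : I) : List I → (List I →₀ ℂ)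
  | [] => 0
  | j :: l => TF j (evec A i l) + if i = j then TH A i (Finsupp.single l 1) else 0

/-- `E_i` -/
def TE (A : I → I → ℤ) (i : I) : (List I →₀ ℂ) →ₗ[ℂ] (List I →₀ ℂ) :=
  Finsupp.linearCombination ℂ (evec A i)

lemma TF_single (i : I) (l : List I) :
    TF i (Finsupp.single l 1) = Finsupp.single (i :: l) 1 := by
  simp [TF]

lemma TH_single (A : I → I → ℤ) (i : I) (l : List I) :
    TH A i (Finsupp.single l 1) = (-(lw A i l : ℤ) : ℂ) • Finsupp.single l 1 := by
  simp [TH]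

lemma TE_single (A : I → I → ℤ) (i : I) (l : List I) :
    TE A i (Finsupp.single l 1) = evec A i l := by
  simp [TE]

lemma T_ext {f g : (List I →₀ ℂ) →ₗ[ℂ] (List I →₀ ℂ)}
    (h : ∀ l, f (Finsupp.single l 1) = g (Finsupp.single l 1)) : f = g := by
  ext1 l
  ext1
  simpa using h l

lemma T_HF (A : I → I → ℤ) (i j : I) :
    TH A i ∘ₗ TF j - TF j ∘ₗ TH A i = - (((A i j : ℤ) : ℂ) • TF j) := by
  apply T_ext
  intro l
  simp only [LinearMap.sub_apply, LinearMap.comp_apply, TF_single, TH_single, map_smul,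
    LinearMap.neg_apply, LinearMap.smul_apply, lw]
  push_cast
  rw [← sub_smul, ← neg_smul]; congr 1; ring

lemma T_HH (A : I → I → ℤ) (i j : I) :
    TH A i ∘ₗ TH A j - TH A j ∘ₗ TH A i = 0 := by
  apply T_ext
  intro l
  simp only [LinearMap.sub_apply, LinearMap.comp_apply, TH_single, map_smul, LinearMap.zero_apply]
  rw [smul_comm, sub_self]

lemma T_EF (A : I → I → ℤ) (i j : I) :
    TE A i ∘ₗ TF j - TF j ∘ₗ TE A i = if i = j then TH A i else 0 := by
  apply T_ext
  intro l
  simp only [LinearMap.sub_apply, LinearMap.comp_apply, TF_single, TE_single, evec]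
  split_ifs <;> simp

lemma T_HE (A : I → I → ℤ) (i j : I) :
    TH A i ∘ₗ TE A j - TE A j ∘ₗ TH A i = ((A i j : ℤ) : ℂ) • TE A j := by
  apply T_ext
  intro l
  simp only [LinearMap.sub_apply, LinearMap.comp_apply, TE_single, TH_single, map_smul,
    LinearMap.smul_apply]
  induction l with
  | nil => simp [evec]
  | cons k l ih =>
    have h1 : ∀ v, TH A i (TF k v) = TF k (TH A i v) - ((A i k : ℤ) : ℂ) • TF k v := by
      intro v
      have := LinearMap.congr_fun (T_HF A i k) v
      simp only [LinearMap.sub_apply, LinearMap.comp_apply, LinearMap.neg_apply,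
        LinearMap.smul_apply] at this
      rw [sub_eq_iff_eq_add] at this
      rw [this]; abel
    have h2 : TH A i (evec A j l) = (((A i j : ℤ) : ℂ) - (lw A i l : ℤ)) • evec A j l := by
      rw [sub_eq_iff_eq_add] at ih
      rw [ih, ← add_smul, sub_eq_add_neg]
    simp only [evec, map_add, h1, h2, lw, map_smul]
    by_cases hjk : j = k
    · subst hjk
      simp only [if_true, TH_single, map_smul]
      push_cast
      module
    · simp only [hjk, if_false, map_zero]
      push_cast
      module

lemma TE_ne (A : I → I → ℤ) (hdiag : ∀ i, A i i = 2) (i : I) : TE A i ≠ 0 := by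
  intro h
  have h1 : TE A i (Finsupp.single [i, i] 1) = 0 := by rw [h]; rfl
  rw [TE_single] at h1
  simp [evec, TH_single, lw, hdiag] at h1

end Tensor

/-! ### Generators of the free Lie algebra and of the Serre algebra -/

section FreeApi

lemma free_gen {X : Type*} (K : LieSubalgebra ℂ (FreeLieAlgebra ℂ X))
    (h : ∀ x, FreeLieAlgebra.of ℂ x ∈ K) : K = ⊤ := by
  let g : FreeLieAlgebra ℂ X →ₗ⁅ℂ⁆ K :=
    FreeLieAlgebra.lift ℂ (fun x => (⟨FreeLieAlgebra.of ℂ x, h x⟩ : K))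
  have hid : K.incl.comp g = LieHom.id := by
    apply FreeLieAlgebra.hom_ext
    intro x
    simp [g]
  rw [eq_top_iff]
  intro x _
  have := LieHom.congr_fun hid x
  have h2 : ((g x : K) : FreeLieAlgebra ℂ X) = x := this
  rw [← h2]; exact (g x).2

lemma map_adPow {L L' : Type*} [LieRing L] [LieAlgebra ℂ L] [LieRing L'] [LieAlgebra ℂ L']
    (φ : L →ₗ⁅ℂ⁆ L') (x : L) (k : ℕ) (y : L) : φ (adPow x k y) = adPow (φ x) k (φ y) := by
  unfold adPow
  induction k with
  | zero => rfl
  | succ k ih => rw [Function.iterate_succ_apply', Function.iterate_succ_apply', LieHom.map_lie, ih]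

lemma adPow_eq {L : Type*} [LieRing L] [LieAlgebra ℂ L] (x : L) (k : ℕ) (y : L) :
    adPow x k y = ((LieAlgebra.ad ℂ L x) ^ k) y := by
  unfold adPow
  induction k with
  | zero => rfl
  | succ k ih =>
    rw [Function.iterate_succ_apply', pow_succ', Module.End.mul_apply, ih, LieAlgebra.ad_apply]

variable {ι : Type*} (B : ι → ι → ℤ)

/-- The quotient map as a Lie homomorphism. -/
def smkHom : FreeLieAlgebra ℂ (SGen ι) →ₗ⁅ℂ⁆ SerreAlgebra B :=
  { toFun := sMk B
    map_add' := fun _ _ => rfl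
    map_smul' := fun _ _ => rfl
    map_lie' := rfl }

lemma smkHom_apply (x : FreeLieAlgebra ℂ (SGen ι)) : smkHom B x = sMk B x := rfl

lemma smkHom_surj : Function.Surjective (smkHom B) := by
  intro x
  exact Submodule.Quotient.mk_surjective _ x

lemma smkHom_eq_zero (x : FreeLieAlgebra ℂ (SGen ι)) : smkHom B x = 0 ↔
    x ∈ LieSubmodule.lieSpan ℂ (FreeLieAlgebra ℂ (SGen ι)) { x | SerreRel B x } :=
  LieSubmodule.Quotient.mk_eq_zero'

lemma smk_rel (x : FreeLieAlgebra ℂ (SGen ι)) (hx : SerreRel B x) : smkHom B x = 0 :=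
  (smkHom_eq_zero B x).2 (LieSubmodule.subset_lieSpan hx)

lemma serre_gen (K : LieSubalgebra ℂ (SerreAlgebra B)) (he : ∀ i, sMk B (ge i) ∈ K)
    (hf : ∀ i, sMk B (gf i) ∈ K) (hh : ∀ i, sMk B (gh i) ∈ K) : K = ⊤ := by
  have h := free_gen (K.comap (smkHom B)) (by
    rintro (i | i | i)
    · exact he i
    · exact hf i
    · exact hh i)
  rw [eq_top_iff]
  intro x _
  obtain ⟨y, rfl⟩ := smkHom_surj B x
  have : y ∈ K.comap (smkHom B) := h ▸ LieSubalgebra.mem_top y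
  exact this

lemma serre_chev : Chev B (fun i => sMk B (ge i)) (fun i => sMk B (gf i))
    (fun i => sMk B (gh i)) where
  hh i j := by
    have := smk_rel B _ (SerreRel.hh i j)
    rwa [LieHom.map_lie] at this
  ef i j := by
    have := smk_rel B _ (SerreRel.ef i j)
    rw [map_sub, LieHom.map_lie, sub_eq_zero] at this
    refine this.trans ?_
    split_ifs
    · rfl
    · exact map_zero (smkHom B)
  he i j := by
    have := smk_rel B _ (SerreRel.he i j)
    rwa [map_sub, LieHom.map_lie, map_smul, sub_eq_zero] at this
  hf i j := by
    have := smk_rel B _ (SerreRel.hf i j)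
    rwa [map_add, LieHom.map_lie, map_smul, add_eq_zero_iff_eq_neg] at this
  gen := serre_gen B

lemma serre_ade (i j : ι) (hij : i ≠ j) :
    adPow (sMk B (ge i)) (1 - B i j).toNat (sMk B (ge j)) = 0 := by
  have := smk_rel B _ (SerreRel.ade i j hij)
  rwa [map_adPow] at this

lemma serre_adf (i j : ι) (hij : i ≠ j) :
    adPow (sMk B (gf i)) (1 - B i j).toNat (sMk B (gf j)) = 0 := by
  have := smk_rel B _ (SerreRel.adf i j hij)
  rwa [map_adPow] at this

/-- Lifting along the Serre presentation. -/
lemma serre_lift {L : Type*} [LieRing L] [LieAlgebra ℂ L] (e f h : ι → L)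
    (hhh : ∀ i j, ⁅h i, h j⁆ = 0)
    (hef : ∀ i j, ⁅e i, f j⁆ = if i = j then h i else 0)
    (hhe : ∀ i j, ⁅h i, e j⁆ = ((B i j : ℤ) : ℂ) • e j)
    (hhf : ∀ i j, ⁅h i, f j⁆ = - (((B i j : ℤ) : ℂ) • f j))
    (hade : ∀ i j, i ≠ j → adPow (e i) (1 - B i j).toNat (e j) = 0)
    (hadf : ∀ i j, i ≠ j → adPow (f i) (1 - B i j).toNat (f j) = 0) :
    ∃ φ : SerreAlgebra B →ₗ⁅ℂ⁆ L, (∀ i, φ (sMk B (ge i)) = e i) ∧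
      (∀ i, φ (sMk B (gf i)) = f i) ∧ (∀ i, φ (sMk B (gh i)) = h i) := by
  let ρ : FreeLieAlgebra ℂ (SGen ι) →ₗ⁅ℂ⁆ L := FreeLieAlgebra.lift ℂ (fun g => match g with
    | .e i => e i
    | .f i => f i
    | .h i => h i)
  have he : ∀ i, ρ (ge i) = e i := fun i => FreeLieAlgebra.lift_of_apply _ _
  have hf : ∀ i, ρ (gf i) = f i := fun i => FreeLieAlgebra.lift_of_apply _ _
  have hh : ∀ i, ρ (gh i) = h i := fun i => FreeLieAlgebra.lift_of_apply _ _
  have hle : LieSubmodule.lieSpan ℂ (FreeLieAlgebra ℂ (SGen ι)) { x | SerreRel B x } ≤ ρ.ker := by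
    rw [LieSubmodule.lieSpan_le]
    intro x hx
    rw [SetLike.mem_coe, LieHom.mem_ker]
    rcases hx with ⟨i, j⟩ | ⟨i, j⟩ | ⟨i, j⟩ | ⟨i, j⟩ | ⟨i, j, hij⟩ | ⟨i, j, hij⟩
    · rw [LieHom.map_lie, hh, hh, hhh]
    · rw [map_sub, LieHom.map_lie, he, hf, hef]
      split_ifs
      · rw [hh, sub_self]
      · rw [map_zero, sub_self]
    · rw [map_sub, LieHom.map_lie, map_smul, he, hh, hhe, sub_self]
    · rw [map_add, LieHom.map_lie, map_smul, hf, hh, hhf, neg_add_cancel]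
    · rw [map_adPow, he, he, hade i j hij]
    · rw [map_adPow, hf, hf, hadf i j hij]
  let φl : SerreAlgebra B →ₗ[ℂ] L := Submodule.liftQ _ (ρ : FreeLieAlgebra ℂ (SGen ι) →ₗ[ℂ] L)
    (fun x hx => by
      have := hle hx
      rw [LieHom.mem_ker] at this
      exact this)
  have hφl : ∀ x, φl (smkHom B x) = ρ x := fun x => rfl
  let φ : SerreAlgebra B →ₗ⁅ℂ⁆ L := { φl with
    map_lie' := by
      intro x y
      obtain ⟨x, rfl⟩ := smkHom_surj B x
      obtain ⟨y, rfl⟩ := smkHom_surj B y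
      show φl ⁅smkHom B x, smkHom B y⁆ = ⁅φl (smkHom B x), φl (smkHom B y)⁆
      rw [← LieHom.map_lie, hφl, hφl, hφl, LieHom.map_lie] }
  exact ⟨φ, he, hf, hh⟩

end FreeApi

/-! ### Nonvanishing of the generators -/

section Nonvanish

variable {L ι κ : Type*} [LieRing L] [LieAlgebra ℂ L]

/-- Iterated action of the family. -/
def eact (e : ι → L) : List ι → L → L
  | [], x => x
  | i :: l, x => ⁅e i, eact e l x⁆

/-- Family of iterated brackets. -/
def famT (e : ι → L) (θ : κ → L) (x : List ι × κ) : L := eact e x.1 (θ x.2)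

/-- Relations of Chevalley type. -/
structure CRel (B : ι → ι → ℤ) (e f h : ι → L) : Prop where
  hh : ∀ i j, ⁅h i, h j⁆ = 0
  ef : ∀ i j, ⁅e i, f j⁆ = if i = j then h i else 0
  he : ∀ i j, ⁅h i, e j⁆ = ((B i j : ℤ) : ℂ) • e j
  hf : ∀ i j, ⁅h i, f j⁆ = - (((B i j : ℤ) : ℂ) • f j)

lemma CRel.swap {B : ι → ι → ℤ} {e f h : ι → L} (c : CRel B e f h) :
    CRel B f e (fun i => - h i) where
  hh i j := by simp [c.hh]
  ef i j := by
    rw [← lie_skew, c.ef]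
    by_cases hij : i = j
    · subst hij; simp
    · simp [hij, Ne.symm hij]
  he i j := by simp [c.hf]
  hf i j := by simp [c.he]

lemma famT_wt [Fintype ι] {B : ι → ι → ℤ} {e f h : ι → L} (c : CRel B e f h) (θ : κ → L)
    (w : κ → ι → ℤ)
    (hθ : ∀ k, HasWt (fun r => (LieAlgebra.ad ℂ L (h r) : L →ₗ[ℂ] L)) B (w k) (θ k))
    (x : List ι × κ) :
    HasWt (fun r => (LieAlgebra.ad ℂ L (h r) : L →ₗ[ℂ] L)) B (wtw id x.1 + w x.2) (famT e θ x) := by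
  obtain ⟨l, k⟩ := x
  induction l with
  | nil => simpa [famT, eact, wtw] using hθ k
  | cons i l ih =>
    intro r
    have := ih r
    simp only [LieAlgebra.ad_apply, famT, eact, wtw, pair_add, pair_single, id] at this ⊢
    rw [leibniz_lie, this, c.he]
    push_cast
    rw [smul_lie, lie_smul]
    module

lemma famT_stab [Fintype ι] {B : ι → ι → ℤ} {e f h : ι → L} (c : CRel B e f h) (θ : κ → L)
    (w : κ → ι → ℤ)
    (hθ : ∀ k, HasWt (fun r => (LieAlgebra.ad ℂ L (h r) : L →ₗ[ℂ] L)) B (w k) (θ k))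
    (hfθ : ∀ i k, ⁅f i, θ k⁆ = 0) (i : ι) :
    e i ∈ stab (Submodule.span ℂ (Set.range (famT e θ))) ∧
    f i ∈ stab (Submodule.span ℂ (Set.range (famT e θ))) ∧
    h i ∈ stab (Submodule.span ℂ (Set.range (famT e θ))) := by
  have hE : ∀ i, e i ∈ stab (Submodule.span ℂ (Set.range (famT e θ))) := by
    intro i
    apply mem_stab_span
    rintro _ ⟨⟨l, k⟩, rfl⟩
    exact Submodule.subset_span ⟨⟨i :: l, k⟩, rfl⟩
  have hH : ∀ i, h i ∈ stab (Submodule.span ℂ (Set.range (famT e θ))) := by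
    intro i
    apply mem_stab_span
    rintro _ ⟨x, rfl⟩
    have := famT_wt c θ w hθ x i
    simp only [LieAlgebra.ad_apply] at this
    rw [this]
    exact Submodule.smul_mem _ _ (Submodule.subset_span ⟨x, rfl⟩)
  refine ⟨hE i, ?_, hH i⟩
  apply mem_stab_span
  rintro _ ⟨⟨l, k⟩, rfl⟩
  induction l with
  | nil => simp [famT, eact, hfθ]
  | cons j l ih =>
    have hfe : ⁅f i, e j⁆ = if j = i then - h j else 0 := by
      rw [← lie_skew, c.ef]; split_ifs <;> simp
    show ⁅f i, ⁅e j, famT e θ (l, k)⁆⁆ ∈ Submodule.span ℂ (Set.range (famT e θ))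
    rw [leibniz_lie, hfe]
    refine Submodule.add_mem _ ?_ (hE j _ ih)
    split_ifs
    · rw [neg_lie]
      exact Submodule.neg_mem _ (hH j _ (Submodule.subset_span ⟨_, rfl⟩))
    · simp

/-- The Serre elements. -/
def serreEl (A : ι → ι → ℤ) (e : ι → L) (x : {x : ι × ι // x.1 ≠ x.2}) : L :=
  adPow (e x.1.1) (1 - A x.1.1 x.1.2).toNat (e x.1.2)

/-- their weights -/
def serreW (A : ι → ι → ℤ) (x : {x : ι × ι // x.1 ≠ x.2}) : ι → ℤ :=
  (((1 - A x.1.1 x.1.2).toNat : ℕ) : ℤ) • Pi.single x.1.1 1 + Pi.single x.1.2 1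

lemma serreEl_wt [Fintype ι] {B A : ι → ι → ℤ} {e f h : ι → L} (c : CRel B e f h)
    (x : {x : ι × ι // x.1 ≠ x.2}) :
    HasWt (fun r => (LieAlgebra.ad ℂ L (h r) : L →ₗ[ℂ] L)) B (serreW A x) (serreEl A e x) := by
  unfold serreW serreEl
  generalize (1 - A x.1.1 x.1.2).toNat = n
  induction n with
  | zero => intro r; simp [adPow, c.he, pair_single]
  | succ n ih =>
    intro r
    have := ih r
    simp only [LieAlgebra.ad_apply, adPow, pair_add, pair_single,
      Function.iterate_succ_apply'] at this ⊢
    rw [leibniz_lie, this, c.he, smul_lie, lie_smul]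
    have h2 : pair B (((n + 1 : ℕ) : ℤ) • Pi.single x.1.1 1) r =
        pair B ((n : ℤ) • Pi.single x.1.1 1) r + B r x.1.1 := by
      push_cast
      rw [add_smul, pair_add, one_smul, pair_single]
    rw [h2]
    push_cast
    module

lemma serreEl_f {A : ι → ι → ℤ} {e f h : ι → L} (c : CRel A e f h)
    (hsymm : ∀ i j, A i j = A j i)
    (hdiag : ∀ i, A i i = 2)
    (hoff : ∀ i j, i ≠ j → A i j = 0 ∨ A i j = -1)
    (k : ι) (x : {x : ι × ι // x.1 ≠ x.2}) : ⁅f k, serreEl A e x⁆ = 0 := by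
  obtain ⟨⟨i, j⟩, hij⟩ := x
  simp only at hij
  have hfe : ∀ a b, ⁅f a, e b⁆ = if b = a then - h b else 0 := by
    intro a b
    rw [← lie_skew, c.ef]; split_ifs <;> simp
  have heh : ∀ a b, ⁅e a, h b⁆ = -(((A b a : ℤ) : ℂ) • e a) := by
    intro a b; rw [← lie_skew, c.he]
  have h1 : ⁅f k, ⁅e i, e j⁆⁆ = (if i = k then -(((A i j : ℤ) : ℂ) • e j) else 0) +
      (if j = k then (((A i j : ℤ) : ℂ) • e i) else 0) := by
    rw [leibniz_lie, hfe, hfe]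
    congr 1
    · split_ifs
      · rw [neg_lie, c.he]
      · simp
    · split_ifs
      · rw [lie_neg, heh, neg_neg, hsymm]
      · simp
  simp only [serreEl]
  rcases hoff i j hij with h0 | h0
  · rw [h0]
    have : adPow (e i) (1 - 0 : ℤ).toNat (e j) = ⁅e i, e j⁆ := rfl
    rw [this, h1, h0]; simp
  · rw [h0]
    have : adPow (e i) (1 - -1 : ℤ).toNat (e j) = ⁅e i, ⁅e i, e j⁆⁆ := rfl
    rw [this, leibniz_lie, h1, h0, hfe]
    by_cases hik : i = k
    · subst hik
      have hji : j ≠ i := Ne.symm hij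
      simp only [if_true, hji, if_false, add_zero, neg_lie]
      rw [leibniz_lie, c.he, c.he, h0, hdiag, smul_lie, lie_smul]
      push_cast
      simp only [neg_smul, one_smul, neg_neg]
      module
    · by_cases hjk : j = k
      · subst hjk; simp [hij]
      · simp [hik, hjk]

end Nonvanish

section Nonvanish2

attribute [local instance] LieRing.ofAssociativeRing

lemma pair_inj_of_pos {R : Type*} [Fintype R] (A' : R → R → ℤ)
    (h : ∀ β : R → ℤ, β ≠ 0 →
      ∃ d : R → ℝ, (∀ r, 0 < d r) ∧ 0 < ∑ r, d r * β r * (pair A' β r : ℝ)) :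
    ∀ β γ : R → ℤ, pair A' β = pair A' γ → β = γ := by
  intro β γ hβγ
  by_contra hne
  obtain ⟨d, _, hd⟩ := h (β - γ) (sub_ne_zero.2 hne)
  have : ∀ r, pair A' (β - γ) r = 0 := by
    intro r; rw [pair_sub, hβγ, sub_self]
  simp [this] at hd

lemma pair_pos_of_pos {R : Type*} [Fintype R] (A' : R → R → ℤ)
    (h : ∀ β : R → ℤ, β ≠ 0 →
      ∃ d : R → ℝ, (∀ r, 0 < d r) ∧ 0 < ∑ r, d r * β r * (pair A' β r : ℝ)) :
    ∀ β : R → ℤ, 0 ≤ β → β ≠ 0 → ∃ r, 0 < pair A' β r := by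
  intro β hβ hne
  obtain ⟨d, hd0, hd⟩ := h β hne
  by_contra hcon
  push Not at hcon
  refine absurd hd (not_lt.2 (Finset.sum_nonpos fun r _ => ?_))
  refine mul_nonpos_of_nonneg_of_nonpos (mul_nonneg (hd0 r).le ?_) ?_
  · exact_mod_cast hβ r
  · exact_mod_cast hcon r

variable {I : Type*} [Fintype I]

lemma T_crel (A : I → I → ℤ) :
    CRel (L := Module.End ℂ (List I →₀ ℂ)) A (TE A) TF (TH A) where
  hh i j := T_HH A i j
  ef i j := T_EF A i j
  he i j := T_HE A i j
  hf i j := T_HF A i j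

lemma sum_serreW (A : I → I → ℤ) (hoff : ∀ i j, i ≠ j → A i j = 0 ∨ A i j = -1)
    (x : {x : I × I // x.1 ≠ x.2}) : 2 ≤ ∑ r, serreW A x r := by
  have h1 : ∑ r, serreW A x r = (((1 - A x.1.1 x.1.2).toNat : ℕ) : ℤ) + 1 := by
    simp [serreW, Finset.sum_add_distrib, Pi.single_apply]
  rw [h1]
  rcases hoff _ _ x.2 with h | h <;> rw [h] <;> decide

lemma e_ne_zero_aux {L : Type*} [LieRing L] [LieAlgebra ℂ L] (A : I → I → ℤ)
    (TE TF TH : I → L) (c : CRel A TE TF TH) (TE_ne : ∀ i, TE i ≠ 0)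
    (hsymm : ∀ i j, A i j = A j i)
    (hdiag : ∀ i, A i i = 2)
    (hoff : ∀ i j, i ≠ j → A i j = 0 ∨ A i j = -1)
    (hposdef : Matrix.PosDef (Matrix.of fun i j : I => (A i j : ℝ))) (i : I) :
    sMk A (ge i) ≠ 0 := by
  intro h0
  have hmem := (smkHom_eq_zero A (ge i)).1 h0
  have hinj : ∀ β γ : I → ℤ, pair A β = pair A γ → β = γ :=
    pair_inj_of_pos A (fun β hβ => fold_pos A hposdef id Function.surjective_id A
      (by intro r j; rw [Finset.sum_filter]; simp) β hβ)
  let J1 := Submodule.span ℂ (Set.range (famT TE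
    (serreEl A TE)))
  let J2 := Submodule.span ℂ (Set.range (famT TF
    (serreEl A TF)))
  have s1 := famT_stab c (serreEl A TE) (serreW A) (serreEl_wt c)
    (serreEl_f c hsymm hdiag hoff)
  have s2 := famT_stab c.swap (serreEl A TF) (serreW A) (serreEl_wt c.swap)
    (serreEl_f c.swap hsymm hdiag hoff)
  let ρ : FreeLieAlgebra ℂ (SGen I) →ₗ⁅ℂ⁆ L :=
    FreeLieAlgebra.lift ℂ (fun g => match g with
    | .e i => TE i
    | .f i => TF i
    | .h i => TH i)
  have he : ∀ i, ρ (ge i) = TE i := fun i => FreeLieAlgebra.lift_of_apply _ _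
  have hf : ∀ i, ρ (gf i) = TF i := fun i => FreeLieAlgebra.lift_of_apply _ _
  have hh : ∀ i, ρ (gh i) = TH i := fun i => FreeLieAlgebra.lift_of_apply _ _
  have hst : ∀ y, ∀ t ∈ J1 ⊔ J2, ⁅ρ y, t⁆ ∈ J1 ⊔ J2 := by
    have hy1 : (stab J1).comap ρ = ⊤ := by
      apply free_gen
      rintro (j | j | j)
      · show ρ (ge j) ∈ stab J1
        rw [he]; exact (s1 j).1
      · show ρ (gf j) ∈ stab J1
        rw [hf]; exact (s1 j).2.1
      · show ρ (gh j) ∈ stab J1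
        rw [hh]; exact (s1 j).2.2
    have hy2 : (stab J2).comap ρ = ⊤ := by
      apply free_gen
      rintro (j | j | j)
      · show ρ (ge j) ∈ stab J2
        rw [he]; exact (s2 j).2.1
      · show ρ (gf j) ∈ stab J2
        rw [hf]; exact (s2 j).1
      · show ρ (gh j) ∈ stab J2
        rw [hh]
        have := (stab J2).neg_mem (s2 j).2.2
        simpa using this
    intro y t ht
    obtain ⟨t1, ht1, t2, ht2, rfl⟩ := Submodule.mem_sup.1 ht
    rw [lie_add]
    have hm1 : y ∈ (stab J1).comap ρ := hy1 ▸ LieSubalgebra.mem_top y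
    have hm2 : y ∈ (stab J2).comap ρ := hy2 ▸ LieSubalgebra.mem_top y
    exact Submodule.add_mem_sup (hm1 t1 ht1) (hm2 t2 ht2)
  let K : LieIdeal ℂ (FreeLieAlgebra ℂ (SGen I)) :=
    { (J1 ⊔ J2).comap (ρ : FreeLieAlgebra ℂ (SGen I) →ₗ[ℂ] L) with
      lie_mem := by
        intro x m hm
        show ρ ⁅x, m⁆ ∈ J1 ⊔ J2
        rw [LieHom.map_lie]
        exact hst x _ hm }
  have hle : LieSubmodule.lieSpan ℂ (FreeLieAlgebra ℂ (SGen I)) { x | SerreRel A x } ≤ K := by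
    rw [LieSubmodule.lieSpan_le]
    intro x hx
    show ρ x ∈ J1 ⊔ J2
    rcases hx with ⟨i, j⟩ | ⟨i, j⟩ | ⟨i, j⟩ | ⟨i, j⟩ | ⟨i, j, hij⟩ | ⟨i, j, hij⟩
    · rw [LieHom.map_lie, hh, hh, c.hh]; exact Submodule.zero_mem _
    · rw [map_sub, LieHom.map_lie, he, hf, c.ef]
      have : (if i = j then TH i else 0) - ρ (if i = j then gh i else 0) = 0 := by
        split_ifs
        · rw [hh, sub_self]
        · rw [map_zero, sub_self]
      rw [this]; exact Submodule.zero_mem _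
    · rw [map_sub, LieHom.map_lie, map_smul, he, hh, c.he, sub_self]; exact Submodule.zero_mem _
    · rw [map_add, LieHom.map_lie, map_smul, hf, hh, c.hf, neg_add_cancel]
      exact Submodule.zero_mem _
    · rw [map_adPow, he, he]
      exact Submodule.mem_sup_left (Submodule.subset_span ⟨([], ⟨(i, j), hij⟩), rfl⟩)
    · rw [map_adPow, hf, hf]
      exact Submodule.mem_sup_right (Submodule.subset_span ⟨([], ⟨(i, j), hij⟩), rfl⟩)
  have hEi : TE i ∈ J1 ⊔ J2 := by
    have : ρ (ge i) ∈ J1 ⊔ J2 := hle hmem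
    rwa [he] at this
  let S : (List I × {x : I × I // x.1 ≠ x.2}) ⊕ (List I × {x : I × I // x.1 ≠ x.2}) →
      L :=
    Sum.elim (famT TE
      (serreEl A TE))
      (famT TF
      (serreEl A TF))
  let W : (List I × {x : I × I // x.1 ≠ x.2}) ⊕ (List I × {x : I × I // x.1 ≠ x.2}) →
      I → ℤ :=
    Sum.elim (fun x => wtw id x.1 + serreW A x.2) (fun x => -(wtw id x.1 + serreW A x.2))
  have hspan : TE i ∈ Submodule.span ℂ (Set.range S) := by
    rw [Set.Sum.elim_range, Submodule.span_union]
    exact hEi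
  have hfin := mem_span_of_wt A hinj
    (fun r => LieAlgebra.ad ℂ L (TH r)) S W ?_ (TE i) hspan
    (Pi.single i 1) ?_
  · have hemp : {k | W k = Pi.single i 1} = ∅ := by
      rw [Set.eq_empty_iff_forall_notMem]
      rintro (⟨l, x⟩ | ⟨l, x⟩) hk
      · have h1 := congrArg (fun w : I → ℤ => ∑ r, w r) hk
        have h2 := sum_serreW A hoff x
        have h3 : 0 ≤ ∑ r, wtw id l r := Finset.sum_nonneg fun r _ => wtw_nonneg id l r
        simp [W, Finset.sum_add_distrib, Pi.single_apply] at h1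
        omega
      · have h1 := congrArg (fun w : I → ℤ => ∑ r, w r) hk
        have h2 := sum_serreW A hoff x
        have h3 : 0 ≤ ∑ r, wtw id l r := Finset.sum_nonneg fun r _ => wtw_nonneg id l r
        simp [W, Finset.sum_add_distrib, Pi.single_apply] at h1
        omega
    rw [hemp] at hfin
    exact TE_ne i (by simpa using hfin)
  · rintro (x | x)
    · exact famT_wt c _ _ (serreEl_wt c) x
    · have := famT_wt c.swap _ _ (serreEl_wt (A := A) c.swap) x
      simp only [map_neg] at this
      exact (hasWt_neg (fun r => LieAlgebra.ad ℂ L (TH r)) _ _ _).1 this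
  · intro r
    rw [pair_single]
    exact c.he r i

lemma e_ne_zero (A : I → I → ℤ)
    (hsymm : ∀ i j, A i j = A j i)
    (hdiag : ∀ i, A i i = 2)
    (hoff : ∀ i j, i ≠ j → A i j = 0 ∨ A i j = -1)
    (hposdef : Matrix.PosDef (Matrix.of fun i j : I => (A i j : ℝ))) (i : I) :
    sMk A (ge i) ≠ 0 :=
  e_ne_zero_aux A (TE A) TF (TH A) (T_crel A) (TE_ne A hdiag) hsymm hdiag hoff hposdef i

end Nonvanish2

section Nilp

attribute [local instance] LieRing.ofAssociativeRing

lemma pow_sum_zero {M ι : Type*} [AddCommGroup M] [Module ℂ M] (s : Finset ι)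
    (x : ι → Module.End ℂ M)
    (hc : ∀ i ∈ s, ∀ j ∈ s, Commute (x i) (x j)) (m : ι → ℕ) (y : M)
    (hy : ∀ i ∈ s, (x i ^ (m i + 1)) y = 0) :
    ((∑ i ∈ s, x i) ^ (∑ i ∈ s, m i + 1)) y = 0 := by
  induction s using Finset.induction_on with
  | empty => simp
  | insert a s ha ih =>
    have ih' := ih (fun i hi j hj => hc i (by simp [hi]) j (by simp [hj]))
      (fun i hi => hy i (by simp [hi]))
    rw [Finset.sum_insert ha, Finset.sum_insert ha]
    have hcomm : Commute (x a) (∑ i ∈ s, x i) :=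
      Commute.sum_right _ _ _ fun i hi => hc a (by simp) i (by simp [hi])
    rw [hcomm.add_pow, LinearMap.sum_apply]
    refine Finset.sum_eq_zero fun k hk => ?_
    rw [Finset.mem_range] at hk
    rw [← Nat.cast_comm, Module.End.mul_apply, Module.End.natCast_apply]
    have hz : (x a ^ k * (∑ i ∈ s, x i) ^ (m a + ∑ i ∈ s, m i + 1 - k)) y = 0 := by
      by_cases hk' : m a + 1 ≤ k
      · rw [((hcomm.pow_pow k _)).eq, Module.End.mul_apply]
        obtain ⟨t, rfl⟩ := Nat.exists_eq_add_of_le' hk'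
        rw [pow_add, Module.End.mul_apply, hy a (by simp), map_zero, map_zero]
      · obtain ⟨t, ht⟩ : ∃ t, m a + ∑ i ∈ s, m i + 1 - k = t + (∑ i ∈ s, m i + 1) :=
          ⟨m a - k, by omega⟩
        rw [ht, pow_add, Module.End.mul_apply, Module.End.mul_apply, ih', map_zero, map_zero]
    rw [hz, smul_zero]

variable {L : Type*} [LieRing L] [LieAlgebra ℂ L]

lemma mem_engel_of_lie (x y : L) (h : ⁅x, y⁆ ∈ LieSubalgebra.engel ℂ x) :
    y ∈ LieSubalgebra.engel ℂ x := by
  rw [LieSubalgebra.mem_engel_iff] at h ⊢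
  obtain ⟨n, hn⟩ := h
  exact ⟨n + 1, by rw [pow_succ, Module.End.mul_apply, LieAlgebra.ad_apply, hn]⟩

lemma engel_top {ι : Type*} {B : ι → ι → ℤ} {e f h : ι → L} (c : Chev B e f h) (s : Finset ι)
    (hs : ∀ j, e j ∈ LieSubalgebra.engel ℂ (∑ i ∈ s, e i)) :
    LieSubalgebra.engel ℂ (∑ i ∈ s, e i) = ⊤ := by
  have hh : ∀ j, h j ∈ LieSubalgebra.engel ℂ (∑ i ∈ s, e i) := by
    intro j
    apply mem_engel_of_lie
    rw [← lie_skew, lie_sum]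
    refine neg_mem (sum_mem fun i _ => ?_)
    rw [c.he]
    exact (LieSubalgebra.engel ℂ (∑ i ∈ s, e i)).smul_mem _ (hs i)
  refine c.gen _ hs ?_ hh
  intro j
  apply mem_engel_of_lie
  rw [sum_lie]
  refine sum_mem fun i _ => ?_
  rw [c.ef]
  split_ifs
  · exact hh i
  · exact zero_mem _

/-- Folded Serre relations, applied to one generator. -/
lemma fold_serre {I R : Type*} [Fintype I] (A : I → I → ℤ)
    (hoff : ∀ i j, i ≠ j → A i j = 0 ∨ A i j = -1)
    (π : I → R) (A' : R → R → ℤ)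
    (hA' : ∀ r j, A' r (π j) = ∑ x ∈ Finset.univ.filter (fun x => π x = r), A x j)
    (g : I → L) (hcomm : ∀ i j, π i = π j → ⁅g i, g j⁆ = 0)
    (hser : ∀ i j, i ≠ j → adPow (g i) (1 - A i j).toNat (g j) = 0)
    (r : R) (j : I) (hr : r ≠ π j) :
    ((LieAlgebra.ad ℂ L (∑ i ∈ Finset.univ.filter (fun x => π x = r), g i)) ^
      (1 - A' r (π j)).toNat) (g j) = 0 := by
  have hne : ∀ i ∈ Finset.univ.filter (fun x => π x = r), i ≠ j := by
    rintro i hi rfl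
    simp only [Finset.mem_filter] at hi
    exact hr hi.2.symm
  have hle : ∀ i ∈ Finset.univ.filter (fun x => π x = r), A i j ≤ 0 := by
    intro i hi
    rcases hoff i j (hne i hi) with h | h <;> omega
  have hN : (1 - A' r (π j)).toNat =
      ∑ i ∈ Finset.univ.filter (fun x => π x = r), (-A i j).toNat + 1 := by
    have h1 : ((∑ i ∈ Finset.univ.filter (fun x => π x = r), (-A i j).toNat : ℕ) : ℤ) =
        - A' r (π j) := by
      rw [hA']
      push_cast
      rw [← Finset.sum_neg_distrib]
      refine Finset.sum_congr rfl fun i hi => ?_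
      have := hle i hi
      omega
    omega
  rw [hN, map_sum]
  apply pow_sum_zero
  · intro i hi k hk
    simp only [Finset.mem_filter, Finset.mem_univ, true_and] at hi hk
    have := hcomm i k (hi.trans hk.symm)
    rw [commute_iff_lie_eq, ← LieHom.map_lie, this, map_zero]
  · intro i hi
    have h1 := hser i j (hne i hi)
    have h2 : (1 - A i j).toNat = (-A i j).toNat + 1 := by
      have := hle i hi; omega
    rw [adPow_eq, h2] at h1
    exact h1

end Nilp

section Fixed

lemma fixed_mem {I R N : Type*} [Fintype I] [AddCommGroup N] [Module ℂ N] (σ : Equiv.Perm I)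
    (π : I → R) (hπorb : ∀ i j : I, π i = π j ↔ ∃ k : ℤ, (σ ^ k) i = j)
    (T : N →ₗ[ℂ] N) (g : I → N) (hT : ∀ i, T (g i) = g (σ i)) (U : Submodule ℂ N)
    (hU : ∀ r, ∑ x ∈ Finset.univ.filter (fun x => π x = r), g x ∈ U)
    (v : N) (hv : v ∈ Submodule.span ℂ (Set.range g)) (hfix : T v = v) : v ∈ U := by
  set n := orderOf σ with hn
  have hnpos : 0 < n := orderOf_pos σ
  let P : N →ₗ[ℂ] N := ∑ k ∈ Finset.range n, T ^ k
  have hTk : ∀ k i, (T ^ k) (g i) = g ((σ ^ k) i) := by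
    intro k
    induction k with
    | zero => intro i; rfl
    | succ k ih =>
      intro i
      rw [pow_succ', Module.End.mul_apply, ih, hT, pow_succ', Equiv.Perm.mul_apply]
  have hPg : ∀ i, P (g i) = ∑ k ∈ Finset.range n, g ((σ ^ k) i) := by
    intro i
    simp only [P, LinearMap.sum_apply, hTk]
  have hPσ : ∀ i, P (g (σ i)) = P (g i) := by
    intro i
    rw [hPg, hPg]
    have h1 := Finset.sum_range_succ (fun k => g ((σ ^ k) i)) n
    have h2 := Finset.sum_range_succ' (fun k => g ((σ ^ k) i)) n
    have h3 : (σ ^ n) = 1 := pow_orderOf_eq_one σ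
    rw [h1, h3, pow_zero] at h2
    have h4 := add_right_cancel h2
    rw [h4]
    refine Finset.sum_congr rfl fun k _ => ?_
    rw [pow_succ, Equiv.Perm.mul_apply]
  have hPz : ∀ (k : ℤ) i, P (g ((σ ^ k) i)) = P (g i) := by
    intro k
    induction k using Int.induction_on with
    | zero => intro i; rfl
    | succ k ih =>
      intro i
      rw [zpow_add_one, Equiv.Perm.mul_apply, ih, hPσ]
    | pred k ih =>
      intro i
      rw [zpow_sub_one, Equiv.Perm.mul_apply, ih, ← hPσ]
      simp
  have hPmem : ∀ i, P (g i) ∈ U := by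
    intro i
    let O := Finset.univ.filter (fun x => π x = π i)
    have hc : (O.card : ℂ) ≠ 0 := by
      have : O.card ≠ 0 := Finset.card_ne_zero.2 ⟨i, by simp [O]⟩
      exact_mod_cast this
    refine (Submodule.smul_mem_iff U hc).1 ?_
    have h1 : ∑ x ∈ O, P (g x) = (O.card : ℂ) • P (g i) := by
      rw [Finset.sum_congr rfl (g := fun _ => P (g i)), Finset.sum_const, Nat.cast_smul_eq_nsmul]
      intro x hx
      simp only [O, Finset.mem_filter, Finset.mem_univ, true_and] at hx
      obtain ⟨k, rfl⟩ := (hπorb i x).1 hx.symm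
      exact hPz k i
    rw [← h1]
    simp only [hPg]
    rw [Finset.sum_comm]
    refine Submodule.sum_mem _ fun k _ => ?_
    have h2 : ∑ x ∈ O, g ((σ ^ k) x) = ∑ x ∈ O, g x := by
      refine Finset.sum_equiv (σ ^ k) ?_ (fun _ _ => rfl)
      intro x
      have : π x = π ((σ ^ k) x) := (hπorb _ _).2 ⟨k, by simp⟩
      simp [O, this]
    rw [h2]
    exact hU _
  have hPv : P v ∈ U := by
    have : Submodule.span ℂ (Set.range g) ≤ U.comap P := by
      rw [Submodule.span_le]
      rintro _ ⟨i, rfl⟩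
      exact hPmem i
    exact this hv
  have hTv : ∀ k, (T ^ k) v = v := by
    intro k
    induction k with
    | zero => rfl
    | succ k ih => rw [pow_succ', Module.End.mul_apply, ih, hfix]
  have hPv' : P v = (n : ℂ) • v := by
    simp only [P, LinearMap.sum_apply, hTv, Finset.sum_const, Finset.card_range,
      Nat.cast_smul_eq_nsmul]
  rw [hPv'] at hPv
  exact (Submodule.smul_mem_iff U (by exact_mod_cast hnpos.ne')).1 hPv

/-- The fixed-point subalgebra. -/
def fixedSub {L : Type*} [LieRing L] [LieAlgebra ℂ L] (T : L →ₗ⁅ℂ⁆ L) : LieSubalgebra ℂ L where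
  carrier := {x | T x = x}
  add_mem' {a b} ha hb := by simp only [Set.mem_ofPred_eq] at *; rw [map_add, ha, hb]
  zero_mem' := map_zero T
  smul_mem' a x hx := by simp only [Set.mem_ofPred_eq] at *; rw [map_smul, hx]
  lie_mem' {x y} hx hy := by
    show T ⁅x, y⁆ = ⁅x, y⁆
    have hx : T x = x := hx
    have hy : T y = y := hy
    rw [LieHom.map_lie, hx, hy]

end Fixed

section Main

lemma folded_le {L ι R : Type*} [Fintype R] [LieRing L] [LieAlgebra ℂ L]
    {B : ι → ι → ℤ} {e f h : ι → L} (c : Chev B e f h)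
    (p : ι → R) (A' : R → R → ℤ)
    (hpos : ∀ β : R → ℤ, β ≠ 0 →
      ∃ d : R → ℝ, (∀ r, 0 < d r) ∧ 0 < ∑ r, d r * β r * (pair A' β r : ℝ))
    (hA2 : ∀ r, A' r r = 2) (E F H : R → L)
    (hEF : ∀ r, ⁅E r, F r⁆ = H r)
    (hHE : ∀ s r, ⁅H s, E r⁆ = ((A' s r : ℤ) : ℂ) • E r)
    (hHF : ∀ s r, ⁅H s, F r⁆ = - (((A' s r : ℤ) : ℂ) • F r))
    (hHe : ∀ r i, ⁅H r, e i⁆ = ((A' r (p i) : ℤ) : ℂ) • e i)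
    (hHf : ∀ r i, ⁅H r, f i⁆ = - (((A' r (p i) : ℤ) : ℂ) • f i))
    (hHh : ∀ r i, ⁅H r, h i⁆ = 0)
    (hce : ∀ i j, p i = p j → ⁅e i, e j⁆ = 0)
    (hcf : ∀ i j, p i = p j → ⁅f i, f j⁆ = 0)
    (hnE : ∀ r, LieSubalgebra.engel ℂ (E r) = ⊤)
    (hnF : ∀ r, LieSubalgebra.engel ℂ (F r) = ⊤)
    (U V : Submodule ℂ L) (hUE : ∀ r, ∀ v ∈ U, ⁅E r, v⁆ ∈ U) (hUF : ∀ r, ∀ v ∈ U, ⁅F r, v⁆ ∈ U)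
    (hVE : ∀ r, ∀ v ∈ V, ⁅E r, v⁆ ∈ V) (hVF : ∀ r, ∀ v ∈ V, ⁅F r, v⁆ ∈ V)
    (hb0 : ∀ v ∈ V, v ∈ Submodule.span ℂ (Set.range h) → v ∈ U)
    (hb1 : ∀ r, ∀ v ∈ V, v ∈ Submodule.span ℂ (e '' {i | p i = r}) → v ∈ U)
    (hb2 : ∀ r, ∀ v ∈ V, v ∈ Submodule.span ℂ (f '' {i | p i = r}) → v ∈ U) : V ≤ U := by
  have hinj := pair_inj_of_pos A' hpos
  have hcr : ∀ x y v : L, ⁅x, ⁅y, v⁆⁆ = ⁅y, ⁅x, v⁆⁆ + ⁅⁅x, y⁆, v⁆ := by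
    intro x y v
    rw [lie_lie]; abel
  refine all_weights A' (pair_pos_of_pos A' hpos) hA2
    (fun r => (LieAlgebra.ad ℂ L (E r) : L →ₗ[ℂ] L))
    (fun r => (LieAlgebra.ad ℂ L (F r) : L →ₗ[ℂ] L))
    (fun r => (LieAlgebra.ad ℂ L (H r) : L →ₗ[ℂ] L))
    ?_ ?_ ?_ U V hUE hUF hVE hVF ?_ ?_ ?_ ?_ ?_ ?_ ?_
  · intro r v
    simp only [LieAlgebra.ad_apply]
    rw [hcr, hEF]
  · intro s r v
    simp only [LieAlgebra.ad_apply]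
    rw [hcr, hHE, smul_lie]
  · intro s r v
    simp only [LieAlgebra.ad_apply]
    rw [hcr, hHF, neg_lie, smul_lie, sub_eq_add_neg]
  · intro r v _
    have hm : v ∈ LieSubalgebra.engel ℂ (E r) := hnE r ▸ LieSubalgebra.mem_top v
    rw [LieSubalgebra.mem_engel_iff] at hm
    obtain ⟨n, hn⟩ := hm
    exact ⟨n, by rw [hn]; exact U.zero_mem⟩
  · intro r v _
    have hm : v ∈ LieSubalgebra.engel ℂ (F r) := hnF r ▸ LieSubalgebra.mem_top v
    rw [LieSubalgebra.mem_engel_iff] at hm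
    obtain ⟨n, hn⟩ := hm
    exact ⟨n, by rw [hn]; exact U.zero_mem⟩
  · intro β v _ hw hvU
    exact wt_sign c p A' hinj H hHe hHf hHh β v hw (fun h0 => hvU (h0 ▸ U.zero_mem))
  · intro v hv hw
    exact hb0 v hv (wt_zero c p A' hinj H hHe hHf hHh v hw)
  · intro r k hk v hv hw
    exact hb1 r v hv (wt_pos c p A' hinj H hHe hHf hHh hce r k hk v hw)
  · intro r k hk v hv hw
    exact hb2 r v hv (wt_neg c p A' hinj H hHe hHf hHh hcf r k hk v hw)
  · refine stable_span A' hinj _ (famS e f h) (famW p) (fam_wt p A' H e f h hHe hHf hHh)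
      (famS_span c) V ?_
    intro r v hv
    simp only [LieAlgebra.ad_apply]
    rw [← hEF, lie_lie]
    exact V.sub_mem (hVE r _ (hVF r v hv)) (hVF r _ (hVE r v hv))

/-- Linear independence of the coroots. -/
lemma h_indep {L I : Type*} [Fintype I] [LieRing L] [LieAlgebra ℂ L] (A : I → I → ℤ)
    {e f h : I → L} (c : Chev A e f h)
    (hsymm : ∀ i j, A i j = A j i)
    (hposdef : Matrix.PosDef (Matrix.of fun i j : I => (A i j : ℝ)))
    (hne : ∀ i, e i ≠ 0) (a : I → ℂ) (ha : ∑ i, a i • h i = 0) : a = 0 := by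
  have key : ∀ j, ∑ i, a i * ((A i j : ℤ) : ℂ) = 0 := by
    intro j
    have h1 : ⁅∑ i, a i • h i, e j⁆ = (∑ i, a i * ((A i j : ℤ) : ℂ)) • e j := by
      rw [sum_lie, Finset.sum_smul]
      refine Finset.sum_congr rfl fun i _ => ?_
      rw [smul_lie, c.he, smul_smul]
    rw [ha, zero_lie] at h1
    exact (smul_eq_zero.1 h1.symm).resolve_right (hne j)
  have real : ∀ x : I → ℝ, (∀ j, ∑ i, x i * (A i j : ℝ) = 0) → x = 0 := by
    intro x hx
    by_contra hx0
    have h1 := hposdef.dotProduct_mulVec_pos hx0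
    refine h1.ne' ?_
    have : (Matrix.of fun i j : I => (A i j : ℝ)).mulVec x = 0 := by
      funext j
      rw [Matrix.mulVec, Pi.zero_apply, ← hx j, dotProduct]
      refine Finset.sum_congr rfl fun i _ => ?_
      rw [Matrix.of_apply, hsymm, mul_comm]
    rw [this, dotProduct_zero]
  have hre := real (fun i => (a i).re) (fun j => by
    have := congrArg Complex.re (key j)
    simpa using this)
  have him := real (fun i => (a i).im) (fun j => by
    have := congrArg Complex.im (key j)
    simpa using this)
  funext i
  exact Complex.ext (congrFun hre i) (congrFun him i)

lemma folding_core {I R : Type*} [Fintype I] [Fintype R]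
    (A : I → I → ℤ) (σ : Equiv.Perm I)
    (hsymm : ∀ i j, A i j = A j i)
    (hdiag : ∀ i, A i i = 2)
    (hoff : ∀ i j, i ≠ j → A i j = 0 ∨ A i j = -1)
    (hposdef : Matrix.PosDef (Matrix.of fun i j : I => (A i j : ℝ)))
    (π : I → R) (hπsurj : Function.Surjective π)
    (hadm : ∀ i j, π i = π j → i ≠ j → A i j = 0)
    (hπorb : ∀ i j : I, π i = π j ↔ ∃ k : ℤ, (σ ^ k) i = j)
    (A' : R → R → ℤ)
    (hA' : ∀ r j, A' r (π j) = ∑ x ∈ Finset.univ.filter (fun x => π x = r), A x j)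
    {L L' : Type*} [LieRing L] [LieAlgebra ℂ L] [LieRing L'] [LieAlgebra ℂ L']
    {e f h : I → L} {e' f' h' : R → L'} (c : Chev A e f h) (c' : Chev A' e' f' h')
    (hene : ∀ i, e i ≠ 0)
    (hser : ∀ i j, i ≠ j → adPow (e i) (1 - A i j).toNat (e j) = 0)
    (hserf : ∀ i j, i ≠ j → adPow (f i) (1 - A i j).toNat (f j) = 0)
    (hser' : ∀ i j, i ≠ j → adPow (e' i) (1 - A' i j).toNat (e' j) = 0)
    (hserf' : ∀ i j, i ≠ j → adPow (f' i) (1 - A' i j).toNat (f' j) = 0)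
    (hlift : ∀ e f h : R → L, (∀ i j, ⁅h i, h j⁆ = 0) →
      (∀ i j, ⁅e i, f j⁆ = if i = j then h i else 0) →
      (∀ i j, ⁅h i, e j⁆ = ((A' i j : ℤ) : ℂ) • e j) →
      (∀ i j, ⁅h i, f j⁆ = - (((A' i j : ℤ) : ℂ) • f j)) →
      (∀ i j, i ≠ j → adPow (e i) (1 - A' i j).toNat (e j) = 0) →
      (∀ i j, i ≠ j → adPow (f i) (1 - A' i j).toNat (f j) = 0) →
      ∃ φ : L' →ₗ⁅ℂ⁆ L, (∀ r, φ (e' r) = e r) ∧ (∀ r, φ (f' r) = f r) ∧ (∀ r, φ (h' r) = h r))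
    (σhat : L →ₗ⁅ℂ⁆ L)
    (hσe : ∀ i : I, σhat (e i) = e (σ i))
    (hσf : ∀ i : I, σhat (f i) = f (σ i))
    (hσh : ∀ i : I, σhat (h i) = h (σ i)) :
    ∃ φ : L' →ₗ⁅ℂ⁆ L,
      Function.Injective φ ∧
      Set.range φ = { x | σhat x = x } ∧
      (∀ r : R,
        φ (e' r) = ∑ x ∈ Finset.univ.filter (fun x => π x = r), e x ∧
        φ (f' r) = ∑ x ∈ Finset.univ.filter (fun x => π x = r), f x ∧
        φ (h' r) = ∑ x ∈ Finset.univ.filter (fun x => π x = r), h x) := by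
  have hpos := fold_pos A hposdef π hπsurj A' hA'
  have hA2 : ∀ r, A' r r = 2 := by
    intro r
    obtain ⟨j, rfl⟩ := hπsurj r
    rw [hA', Finset.sum_eq_single j, hdiag]
    · intro i hi hij
      simp only [Finset.mem_filter, Finset.mem_univ, true_and] at hi
      exact hadm i j hi hij
    · intro hj; simp at hj
  have hce : ∀ i j, π i = π j → ⁅e i, e j⁆ = 0 := by
    intro i j hij
    by_cases hh : i = j
    · rw [hh, lie_self]
    · have := hser i j hh
      rw [hadm i j hij hh] at this
      exact this
  have hcf : ∀ i j, π i = π j → ⁅f i, f j⁆ = 0 := by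
    intro i j hij
    by_cases hh : i = j
    · rw [hh, lie_self]
    · have := hserf i j hh
      rw [hadm i j hij hh] at this
      exact this
  have fse := fold_serre A hoff π A' hA' e hce hser
  have fsf := fold_serre A hoff π A' hA' f hcf hserf
  obtain ⟨cgen, chh, cef, che, chf⟩ : _ ∧ _ ∧ _ ∧ _ ∧ _ := ⟨c.gen, c.hh, c.ef, c.he, c.hf⟩
  beta_reduce at fse fsf chh cef che chf
  set O : R → Finset I := fun r => Finset.univ.filter (fun x => π x = r) with hO
  have hmO : ∀ r x, x ∈ O r ↔ π x = r := by intro r x; simp [hO]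
  obtain ⟨E, hE⟩ : ∃ E : R → L, ∀ r, E r = ∑ x ∈ O r, e x := ⟨_, fun _ => rfl⟩
  obtain ⟨F, hF⟩ : ∃ E : R → L, ∀ r, E r = ∑ x ∈ O r, f x := ⟨_, fun _ => rfl⟩
  obtain ⟨H, hH⟩ : ∃ E : R → L, ∀ r, E r = ∑ x ∈ O r, h x := ⟨_, fun _ => rfl⟩
  have hHe : ∀ r i, ⁅H r, e i⁆ = ((A' r (π i) : ℤ) : ℂ) • e i := by
    intro r i
    rw [hH, sum_lie, hA']
    push_cast
    rw [Finset.sum_smul]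
    exact Finset.sum_congr rfl fun x _ => che x i
  have hHf : ∀ r i, ⁅H r, f i⁆ = -(((A' r (π i) : ℤ) : ℂ) • f i) := by
    intro r i
    rw [hH, sum_lie, hA']
    push_cast
    rw [Finset.sum_smul, ← Finset.sum_neg_distrib]
    exact Finset.sum_congr rfl fun x _ => chf x i
  have hHh : ∀ r i, ⁅H r, h i⁆ = 0 := by
    intro r i
    rw [hH, sum_lie]
    exact Finset.sum_eq_zero fun x _ => chh x i
  have hHH : ∀ r s, ⁅H r, H s⁆ = 0 := by
    intro r s
    rw [hH s, lie_sum]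
    exact Finset.sum_eq_zero fun x _ => hHh r x
  have hHE : ∀ r s, ⁅H r, E s⁆ = ((A' r s : ℤ) : ℂ) • E s := by
    intro r s
    rw [hE s, lie_sum, Finset.smul_sum]
    refine Finset.sum_congr rfl fun x hx => ?_
    rw [hHe, (hmO s x).1 hx]
  have hHF : ∀ r s, ⁅H r, F s⁆ = -(((A' r s : ℤ) : ℂ) • F s) := by
    intro r s
    rw [hF s, lie_sum, Finset.smul_sum, ← Finset.sum_neg_distrib]
    refine Finset.sum_congr rfl fun x hx => ?_
    rw [hHf, (hmO s x).1 hx]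
  have hEf : ∀ r j, ⁅E r, f j⁆ = if π j = r then h j else 0 := by
    intro r j
    rw [hE, sum_lie]
    simp only [cef]
    rw [Finset.sum_ite_eq' (O r) j (fun x => h x)]
    simp only [hmO]
  have hFe : ∀ r j, ⁅F r, e j⁆ = - if π j = r then h j else 0 := by
    intro r j
    rw [← lie_skew, hF, lie_sum]
    simp only [cef]
    rw [Finset.sum_ite_eq (O r) j (fun x => h j)]
    simp only [hmO]
  have hEF : ∀ r s, ⁅E r, F s⁆ = if r = s then H r else 0 := by
    intro r s
    rw [hF s, lie_sum]
    by_cases hrs : r = s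
    · subst hrs
      rw [if_pos rfl, hH]
      exact Finset.sum_congr rfl fun x hx => by rw [hEf, if_pos ((hmO r x).1 hx)]
    · rw [if_neg hrs]
      exact Finset.sum_eq_zero fun x hx => by
        rw [hEf, if_neg (fun h => hrs (h.symm.trans ((hmO s x).1 hx)))]
  have hsE : ∀ r s, r ≠ s → adPow (E r) (1 - A' r s).toNat (E s) = 0 := by
    intro r s hrs
    rw [adPow_eq, hE s, map_sum]
    refine Finset.sum_eq_zero fun j hj => ?_
    have hj := (hmO s j).1 hj
    rw [hE, ← hj]
    exact fse r j (by rw [hj]; exact hrs)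
  have hsF : ∀ r s, r ≠ s → adPow (F r) (1 - A' r s).toNat (F s) = 0 := by
    intro r s hrs
    rw [adPow_eq, hF s, map_sum]
    refine Finset.sum_eq_zero fun j hj => ?_
    have hj := (hmO s j).1 hj
    rw [hF, ← hj]
    exact fsf r j (by rw [hj]; exact hrs)
  obtain ⟨φ, hφe, hφf, hφh⟩ := hlift E F H hHH hEF hHE hHF hsE hsF
  -- nilpotency on the big algebra
  have hnE : ∀ r, LieSubalgebra.engel ℂ (E r) = ⊤ := by
    intro r
    rw [hE]
    refine engel_top c (O r) ?_
    intro j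
    by_cases hj : π j = r
    · apply mem_engel_of_lie
      have hz : ⁅∑ i ∈ O r, e i, e j⁆ = 0 := by
        rw [sum_lie]
        exact Finset.sum_eq_zero fun i hi => hce i j (((hmO r i).1 hi).trans hj.symm)
      rw [hz]
      exact zero_mem _
    · rw [LieSubalgebra.mem_engel_iff]
      exact ⟨_, fse r j (Ne.symm hj)⟩
  have hnF : ∀ r, LieSubalgebra.engel ℂ (F r) = ⊤ := by
    intro r
    rw [hF]
    refine engel_top c.swap (O r) ?_
    intro j
    by_cases hj : π j = r
    · apply mem_engel_of_lie
      have hz : ⁅∑ i ∈ O r, f i, f j⁆ = 0 := by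
        rw [sum_lie]
        exact Finset.sum_eq_zero fun i hi => hcf i j (((hmO r i).1 hi).trans hj.symm)
      rw [hz]
      exact zero_mem _
    · rw [LieSubalgebra.mem_engel_iff]
      exact ⟨_, fsf r j (Ne.symm hj)⟩
  -- nilpotency on the folded algebra
  have hnE' : ∀ r, LieSubalgebra.engel ℂ (e' r) = ⊤ := by
    intro r
    have := engel_top c' {r} ?_
    · simpa using this
    intro j
    rw [Finset.sum_singleton]
    by_cases hj : r = j
    · subst hj
      apply mem_engel_of_lie
      rw [lie_self]; exact zero_mem _
    · rw [LieSubalgebra.mem_engel_iff]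
      exact ⟨_, by rw [← adPow_eq]; exact hser' r j hj⟩
  have hnF' : ∀ r, LieSubalgebra.engel ℂ (f' r) = ⊤ := by
    intro r
    have := engel_top c'.swap {r} ?_
    · simpa using this
    intro j
    rw [Finset.sum_singleton]
    by_cases hj : r = j
    · subst hj
      apply mem_engel_of_lie
      rw [lie_self]; exact zero_mem _
    · rw [LieSubalgebra.mem_engel_iff]
      exact ⟨_, by rw [← adPow_eq]; exact hserf' r j hj⟩
  -- fixed points
  have hπσ : ∀ i, π (σ i) = π i := fun i => ((hπorb i (σ i)).2 ⟨1, by simp⟩).symm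
  have hsumσ : ∀ (g : I → L) r, ∑ x ∈ O r, g (σ x) = ∑ x ∈ O r, g x := by
    intro g r
    refine Finset.sum_equiv σ ?_ (fun _ _ => rfl)
    intro x
    rw [hmO, hmO, hπσ]
  have hσE : ∀ r, σhat (E r) = E r := by
    intro r
    rw [hE, map_sum, ← hsumσ e]
    exact Finset.sum_congr rfl fun x _ => hσe x
  have hσF : ∀ r, σhat (F r) = F r := by
    intro r
    rw [hF, map_sum, ← hsumσ f]
    exact Finset.sum_congr rfl fun x _ => hσf x
  have hσH : ∀ r, σhat (H r) = H r := by
    intro r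
    rw [hH, map_sum, ← hsumσ h]
    exact Finset.sum_congr rfl fun x _ => hσh x
  have hrange : ∀ y, σhat (φ y) = φ y := by
    have hK : (fixedSub σhat).comap φ = ⊤ := by
      apply c'.gen
      · intro r
        show σhat (φ _) = φ _
        rw [hφe, hσE]
      · intro r
        show σhat (φ _) = φ _
        rw [hφf, hσF]
      · intro r
        show σhat (φ _) = φ _
        rw [hφh, hσH]
    intro y
    have : y ∈ (fixedSub σhat).comap φ := hK ▸ LieSubalgebra.mem_top y
    exact this
  have hfne : ∀ r, E r ≠ 0 := by
    intro r h0
    obtain ⟨j, hj⟩ := hπsurj r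
    have h1 := hEf r j
    rw [h0, zero_lie, if_pos hj] at h1
    have h2 := che j j
    rw [← h1, zero_lie, hdiag] at h2
    exact (smul_ne_zero (by norm_num) (hene j)) h2.symm
  have hfne' : ∀ r, F r ≠ 0 := by
    intro r h0
    obtain ⟨j, hj⟩ := hπsurj r
    have h1 := hFe r j
    rw [h0, zero_lie, if_pos hj] at h1
    have h2 := che j j
    rw [neg_eq_zero.1 h1.symm, zero_lie, hdiag] at h2
    exact (smul_ne_zero (by norm_num) (hene j)) h2.symm
  refine ⟨φ, ?_, ?_, ?_⟩
  · -- injectivity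
    have hker : LinearMap.ker (φ : L' →ₗ[ℂ] L) ≤ ⊥ := by
      have hmk : ∀ v, v ∈ LinearMap.ker (φ : L' →ₗ[ℂ] L) ↔ φ v = 0 :=
        fun v => Iff.rfl
      have hst : ∀ x : L', ∀ v ∈ LinearMap.ker (φ : L' →ₗ[ℂ] L),
          ⁅x, v⁆ ∈ LinearMap.ker (φ : L' →ₗ[ℂ] L) := by
        intro x v hv
        rw [hmk] at hv ⊢
        rw [LieHom.map_lie, hv, lie_zero]
      have hbot : ∀ x : L', ∀ v ∈ (⊥ : Submodule ℂ (L')),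
          ⁅x, v⁆ ∈ (⊥ : Submodule ℂ (L')) := by
        intro x v hv
        rw [Submodule.mem_bot] at hv ⊢
        rw [hv, lie_zero]
      refine folded_le c' id A' hpos hA2 e' f'
        h' ?_ c'.he c'.hf c'.he c'.hf c'.hh ?_ ?_ hnE' hnF' _ _
        (fun r => hbot _) (fun r => hbot _) (fun r => hst _) (fun r => hst _) ?_ ?_ ?_
      · intro r
        rw [c'.ef, if_pos rfl]
      · intro i j hij
        rw [show i = j from hij, lie_self]
      · intro i j hij
        rw [show i = j from hij, lie_self]
      · intro v hv hs
        rw [hmk] at hv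
        obtain ⟨a, rfl⟩ := (Submodule.mem_span_range_iff_exists_fun ℂ).1 hs
        have h1 : ∑ i, a (π i) • h i = 0 := by
          rw [← hv, map_sum, ← Finset.sum_fiberwise Finset.univ π]
          refine Finset.sum_congr rfl fun r _ => ?_
          rw [map_smul, hφh, hH, Finset.smul_sum]
          refine Finset.sum_congr rfl fun i hi => ?_
          rw [(hmO r i).1 hi]
        have h2 := h_indep A c hsymm hposdef hene _ h1
        rw [Submodule.mem_bot]
        refine Finset.sum_eq_zero fun r _ => ?_
        obtain ⟨j, rfl⟩ := hπsurj r
        have h3 : a (π j) = 0 := congrFun h2 j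
        rw [h3, zero_smul]
      · intro r v hv hs
        rw [hmk] at hv
        have hset : {i : R | id i = r} = {r} := rfl
        rw [hset, Set.image_singleton] at hs
        obtain ⟨a, rfl⟩ := Submodule.mem_span_singleton.1 hs
        rw [map_smul, hφe] at hv
        rw [(smul_eq_zero.1 hv).resolve_right (hfne r), zero_smul]
        exact Submodule.zero_mem _
      · intro r v hv hs
        rw [hmk] at hv
        have hset : {i : R | id i = r} = {r} := rfl
        rw [hset, Set.image_singleton] at hs
        obtain ⟨a, rfl⟩ := Submodule.mem_span_singleton.1 hs
        rw [map_smul, hφf] at hv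
        rw [(smul_eq_zero.1 hv).resolve_right (hfne' r), zero_smul]
        exact Submodule.zero_mem _
    exact LinearMap.ker_eq_bot.1 (le_bot_iff.1 hker)
  · -- surjectivity
    have hmr : ∀ v, v ∈ LinearMap.range (φ : L' →ₗ[ℂ] L) ↔
        ∃ y, φ y = v := fun v => Iff.rfl
    have hmf : ∀ v, v ∈ (fixedSub σhat).toSubmodule ↔ σhat v = v := fun v => Iff.rfl
    have hle : (fixedSub σhat).toSubmodule ≤
        LinearMap.range (φ : L' →ₗ[ℂ] L) := by
      have hUst : ∀ x, ∀ v ∈ LinearMap.range (φ : L' →ₗ[ℂ] L),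
          ⁅φ x, v⁆ ∈ LinearMap.range (φ : L' →ₗ[ℂ] L) := by
        intro x v hv
        rw [hmr] at hv ⊢
        obtain ⟨y, rfl⟩ := hv
        exact ⟨⁅x, y⁆, LieHom.map_lie _ _ _⟩
      have hVst : ∀ x, ∀ v ∈ (fixedSub σhat).toSubmodule,
          ⁅φ x, v⁆ ∈ (fixedSub σhat).toSubmodule := by
        intro x v hv
        rw [hmf] at hv ⊢
        rw [LieHom.map_lie, hrange, hv]
      refine folded_le c π A' hpos hA2 E F H ?_ hHE hHF hHe hHf hHh hce hcf hnE hnF _ _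
        ?_ ?_ ?_ ?_ ?_ ?_ ?_
      · intro r
        rw [hEF, if_pos rfl]
      · intro r; rw [← hφe]; exact hUst _
      · intro r; rw [← hφf]; exact hUst _
      · intro r; rw [← hφe]; exact hVst _
      · intro r; rw [← hφf]; exact hVst _
      · intro v hv hs
        refine fixed_mem σ π hπorb (σhat : L →ₗ[ℂ] L)
          h hσh _ ?_ v hs hv
        intro r
        exact (hmr _).2 ⟨_, (hφh r).trans (hH r)⟩
      · intro r v hv hs
        refine fixed_mem σ π hπorb (σhat : L →ₗ[ℂ] L)
          e hσe _ ?_ v (Submodule.span_mono (Set.image_subset_range _ _) hs) hv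
        intro r
        exact (hmr _).2 ⟨_, (hφe r).trans (hE r)⟩
      · intro r v hv hs
        refine fixed_mem σ π hπorb (σhat : L →ₗ[ℂ] L)
          f hσf _ ?_ v (Submodule.span_mono (Set.image_subset_range _ _) hs) hv
        intro r
        exact (hmr _).2 ⟨_, (hφf r).trans (hF r)⟩
    apply Set.Subset.antisymm
    · rintro _ ⟨y, rfl⟩
      exact hrange y
    · intro x hx
      exact (hmr x).1 (hle hx)
  · intro r
    exact ⟨(hφe r).trans (hE r), (hφf r).trans (hF r), (hφh r).trans (hH r)⟩

end Main

/-- **Folding of simply-laced semisimple Lie algebras (Theorem on classical folding).**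
Let `A` be a positive definite simply-laced Cartan matrix with admissible diagram automorphism
`σ`, let `𝔤` be the Lie algebra presented by the Serre relations of `A`, and let `𝔤'` be the Lie
algebra presented by the Serre relations of the folded Cartan matrix `A'`.  Then for any lift
`σ̂` of `σ` to `𝔤`, the assignment `e'_r ↦ ∑_{i ∈ O_r} e_i`, `f'_r ↦ ∑_{i ∈ O_r} f_i`,
`h'_r ↦ ∑_{i ∈ O_r} h_i` extends to an isomorphism of `𝔤'` onto the fixed-point subalgebra
`𝔤^σ`. -/
theorem lie_algebra_folding
    {I R : Type*} [Fintype I] [DecidableEq I]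
    (A : I → I → ℤ) (σ : Equiv.Perm I)
    (hsymm : ∀ i j, A i j = A j i)
    (hdiag : ∀ i, A i i = 2)
    (hoff : ∀ i j, i ≠ j → A i j = 0 ∨ A i j = -1)
    (hposdef : Matrix.PosDef (Matrix.of fun i j : I => (A i j : ℝ)))
    (haut : ∀ i j, A (σ i) (σ j) = A i j)
    (hadm : ∀ (i : I) (k : ℤ), (σ ^ k) i ≠ i → A i ((σ ^ k) i) = 0)
    (π : I → R) (hπsurj : Function.Surjective π)
    (hπorb : ∀ i j : I, π i = π j ↔ ∃ k : ℤ, (σ ^ k) i = j)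
    (A' : R → R → ℤ)
    (hA' : ∀ i j : I, A' (π i) (π j) = ∑ x ∈ sigmaOrbit σ i, A x j)
    (σhat : SerreAlgebra A →ₗ⁅ℂ⁆ SerreAlgebra A)
    (hσe : ∀ i : I, σhat (sMk A (ge i)) = sMk A (ge (σ i)))
    (hσf : ∀ i : I, σhat (sMk A (gf i)) = sMk A (gf (σ i)))
    (hσh : ∀ i : I, σhat (sMk A (gh i)) = sMk A (gh (σ i))) :
    ∃ φ : SerreAlgebra A' →ₗ⁅ℂ⁆ SerreAlgebra A,
      Function.Injective φ ∧
      Set.range φ = { x | σhat x = x } ∧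
      (∀ i : I,
        φ (sMk A' (ge (π i))) = ∑ x ∈ sigmaOrbit σ i, sMk A (ge x) ∧
        φ (sMk A' (gf (π i))) = ∑ x ∈ sigmaOrbit σ i, sMk A (gf x) ∧
        φ (sMk A' (gh (π i))) = ∑ x ∈ sigmaOrbit σ i, sMk A (gh x)) := by
  have : Fintype R := Fintype.ofSurjective π hπsurj
  have hO : ∀ i, sigmaOrbit σ i = Finset.univ.filter (fun x => π x = π i) := by
    intro i
    ext x
    simp only [sigmaOrbit, Finset.mem_filter, Finset.mem_univ, true_and]
    rw [← hπorb, eq_comm]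
  obtain ⟨φ, h1, h2, h3⟩ := folding_core A σ hsymm hdiag hoff hposdef π hπsurj
    (by
      intro i j hij hne
      obtain ⟨k, rfl⟩ := (hπorb i j).1 hij
      exact hadm i k (Ne.symm hne))
    hπorb A'
    (by
      intro r j
      obtain ⟨i, rfl⟩ := hπsurj r
      rw [hA', hO])
    (serre_chev A) (serre_chev A') (e_ne_zero A hsymm hdiag hoff hposdef)
    (serre_ade A) (serre_adf A) (serre_ade A') (serre_adf A') (serre_lift A')
    σhat hσe hσf hσh
  refine ⟨φ, h1, h2, fun i => ?_⟩
  rw [hO]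
  exact h3 (π i)

end
end

section
/- Let U_q^+(so_8) be the ℂ(q)-algebra presented by generators E_0, E_1, E_2, E_3 (node 0 being the central node of the D_4 diagram) and relations: E_iE_j = E_jE_i for distinct i,j ∈ {1,2,3}; and E_i²E_0 − (q+q^{−1})E_iE_0E_i + E_0E_i² = 0, E_0²E_i − (q+q^{−1})E_0E_iE_0 + E_iE_0² = 0 for i ∈ {1,2,3}. Set u = E_0, w = E_1E_2E_3, z_1 = [E_1E_2E_3, E_0]_{q^{−3}} − ((q²+1+q^{−2})/(q−q^{−1})²)·[E_1,[E_2,[E_3,E_0]_{q^{−1}}]_{q^{−1}}]_{q^{−1}}, and z_2 = [E_0, E_1E_2E_3]_{q^{−3}} − ((q²+1+q^{−2})/(q−q^{−1})²)·[[[E_0,E_1]_{q^{−1}},E_2]_{q^{−1}},E_3]_{q^{−1}}. Then the following identities hold in U_q^+(so_8): (1) [u,[u,[u,[u,w]_{q^{−3}}]_{q^{−1}}]_q]_{q³} = 0; (2) [w,[w,u]_{q^{−3}}]_{q³} = [w,z_1]_{q³} = [z_2,w]_{q³} = q([z_1,w]_q + [w,z_2]_q); (3) [z_1,z_2] = (q+q^{−1})[z_1,[w,u]_{q^{−3}}]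 − [z_2,[w,u]_{q^{−3}}]; (4) [z_1,[u,w]_q] = [[w,u]_q, z_2] and [z_1,[z_1,u]_{q^{−1}}]_q = [z_2,[z_2,u]_{q^{−1}}]_q; (5) [z_1,[z_1,u]_{q^{−1}}]_q = q([z_1,[z_2,u]_{q^{−1}}]_q + [z_2,[z_1,u]_{q^{−1}}]_q) + (q−q^{−1})(q[z_1,u]_{q^{−1}}z_2 − z_1[z_2,u]_{q^{−1}}). -/
noncomputable section

/-- The field `ℂ(q)` of rational functions. -/
abbrev Kq := RatFunc ℂ
/-- The variable `q`. -/
def qq : Kq := RatFunc.X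

/-- Generators `E₀, E₁, E₂, E₃` of the free algebra (node `0` is the central node of `D₄`). -/
def Efree (i : Fin 4) : FreeAlgebra Kq (Fin 4) := FreeAlgebra.ι Kq i

/-- The defining relations of `U_q^+(so₈)`: `E_iE_j = E_jE_i` for distinct `i,j ∈ {1,2,3}`, and
the quantum Serre relations between `E₀` and each `E_i`, `i ∈ {1,2,3}`. -/
inductive SO8Rel : FreeAlgebra Kq (Fin 4) → FreeAlgebra Kq (Fin 4) → Prop
  | comm (i j : Fin 4) : i ≠ j → i ≠ 0 → j ≠ 0 → SO8Rel (Efree i * Efree j) (Efree j * Efree i)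
  | serre₁ (i : Fin 4) : i ≠ 0 →
      SO8Rel (Efree i * Efree i * Efree 0 + Efree 0 * Efree i * Efree i)
        ((qq + qq⁻¹) • (Efree i * Efree 0 * Efree i))
  | serre₂ (i : Fin 4) : i ≠ 0 →
      SO8Rel (Efree 0 * Efree 0 * Efree i + Efree i * Efree 0 * Efree 0)
        ((qq + qq⁻¹) • (Efree 0 * Efree i * Efree 0))

/-- `U_q^+(so₈)`. -/
abbrev UqSO8 := RingQuot SO8Rel

/-- The generator `E_i` of `U_q^+(so₈)`. -/
def EE (i : Fin 4) : UqSO8 := RingQuot.mkAlgHom Kq SO8Rel (Efree i)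

/-- The deformed commutator `[a,b]_v = ab − v·ba`. -/
def cmt (a b : UqSO8) (v : Kq) : UqSO8 := a * b - v • (b * a)

/-- `u = E₀`. -/
def uu : UqSO8 := EE 0
/-- `w = E₁E₂E₃`. -/
def ww : UqSO8 := EE 1 * EE 2 * EE 3
/-- `z₁`. -/
def zz1 : UqSO8 :=
  cmt ww uu (qq⁻¹ ^ 3) -
    ((qq ^ 2 + 1 + qq⁻¹ ^ 2) / (qq - qq⁻¹) ^ 2) •
      cmt (EE 1) (cmt (EE 2) (cmt (EE 3) uu qq⁻¹) qq⁻¹) qq⁻¹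
/-- `z₂`. -/
def zz2 : UqSO8 :=
  cmt uu ww (qq⁻¹ ^ 3) -
    ((qq ^ 2 + 1 + qq⁻¹ ^ 2) / (qq - qq⁻¹) ^ 2) •
      cmt (cmt (cmt uu (EE 1) qq⁻¹) (EE 2) qq⁻¹) (EE 3) qq⁻¹


set_option linter.all false

section PBWTheory

theorem asc {A : Type*} [Ring A] {a b r : A} (h : a * b = r) (t : A) : a * (b * t) = r * t := by
  rw [← mul_assoc, h]

section Basic
variable {K A : Type*} [Field K] [Ring A] [Algebra K A] {q : K}

theorem serre_x (hq : q ≠ 0) {x y f : A} (hf : f = x * y - q⁻¹ • (y * x))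
    (h : x * x * y + y * x * x = (q + q⁻¹) • (x * y * x)) : f * x = q⁻¹ • (x * f) := by
  subst hf
  simp only [sub_mul, mul_sub, smul_mul_assoc, mul_smul_comm, mul_assoc] at h ⊢
  linear_combination (norm := skip) (-q⁻¹) • h
  match_scalars <;> field_simp <;> ring

theorem serre_y (hq : q ≠ 0) {x y f : A} (hf : f = x * y - q⁻¹ • (y * x))
    (h : y * y * x + x * y * y = (q + q⁻¹) • (y * x * y)) : y * f = q⁻¹ • (f * y) := by
  subst hf
  simp only [sub_mul, mul_sub, smul_mul_assoc, mul_smul_comm, mul_assoc] at h ⊢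
  linear_combination (norm := skip) (-q⁻¹) • h
  match_scalars <;> field_simp <;> ring

/-- Reading the definition `f = [x, y]_{q⁻¹}` as a straightening rule. -/
theorem def_rule (hq : q ≠ 0) {x y f : A} (hf : f = x * y - q⁻¹ • (y * x)) :
    y * x = q • (x * y) - q • f := by
  subst hf
  match_scalars <;> field_simp <;> ring

/-- `[x₁,[x₂,y]] = [x₂,[x₁,y]]`. -/
theorem def_symm {x1 x2 y f1 f2 f12 : A} (hx : x2 * x1 = x1 * x2)
    (h1 : f1 = x1 * y - q⁻¹ • (y * x1)) (h2 : f2 = x2 * y - q⁻¹ • (y * x2))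
    (h12 : f12 = x1 * f2 - q⁻¹ • (f2 * x1)) : f12 = x2 * f1 - q⁻¹ • (f1 * x2) := by
  subst h12 h1 h2
  simp only [sub_mul, mul_sub, smul_mul_assoc, mul_smul_comm, mul_assoc, hx, asc hx]
  module

/-- If `x₁` commutes with `x₂` and q-commutes with `f`, it q-commutes with `[x₂, f]`. -/
theorem qcomm_x {x1 x2 f h : A} (hx : x2 * x1 = x1 * x2) (hh : h = x2 * f - q⁻¹ • (f * x2))
    (hf : f * x1 = q⁻¹ • (x1 * f)) : h * x1 = q⁻¹ • (x1 * h) := by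
  subst hh
  simp only [sub_mul, mul_sub, smul_mul_assoc, mul_smul_comm, mul_assoc, hx, hf, asc hf, asc hx]
  module

/-- Overlap of `y, f₁, x₂` and `y, f₂, x₁`. -/
theorem overlap (hq : q ≠ 0) (hq2 : q ^ 2 + 1 ≠ 0) {x1 x2 y f1 f2 f12 : A}
    (y1 : y * f1 = q⁻¹ • (f1 * y)) (y2 : y * f2 = q⁻¹ • (f2 * y))
    (yx1 : y * x1 = q • (x1 * y) - q • f1) (yx2 : y * x2 = q • (x2 * y) - q • f2)
    (h12 : f1 * x2 = q • (x2 * f1) - q • f12) (h21 : f2 * x1 = q • (x1 * f2) - q • f12) :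
    f2 * f1 = f1 * f2 ∧ y * f12 = f12 * y + (q⁻¹ - q) • (f1 * f2) := by
  have e1 := asc y1 x2
  have e2 := asc y2 x1
  simp only [sub_mul, mul_sub, smul_mul_assoc, mul_smul_comm, mul_assoc, y1, y2, yx1, yx2, h12, h21,
    asc y1, asc y2, asc yx1, asc yx2, asc h12, asc h21] at e1 e2
  have c : f2 * f1 = f1 * f2 := by
    have : (q ^ 2 + 1) • (f2 * f1) = (q ^ 2 + 1) • (f1 * f2) := by
      linear_combination (norm := skip) (-1 : K) • e1 + (1 : K) • e2
      match_scalars <;> field_simp <;> ring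
    exact smul_right_injective A hq2 this
  refine ⟨c, ?_⟩
  rw [c] at e1
  linear_combination (norm := skip) (-q⁻¹) • e1
  match_scalars <;> field_simp <;> ring

theorem qcomm_f (hq : q ≠ 0) {x1 f1 f2 f12 : A} (c : f2 * f1 = f1 * f2)
    (h11 : f1 * x1 = q⁻¹ • (x1 * f1)) (h21 : f2 * x1 = q • (x1 * f2) - q • f12) :
    f1 * f12 = q⁻¹ • (f12 * f1) := by
  have e := asc c x1
  simp only [sub_mul, mul_sub, smul_mul_assoc, mul_smul_comm, mul_assoc, c, h11, h21, asc c,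
    asc h11, asc h21] at e
  linear_combination (norm := skip) (q⁻¹) • e
  match_scalars <;> field_simp <;> ring

/-- `[f₁₂,f₃] = [f₁₃,f₂]`. -/
theorem g_symm (hq : q ≠ 0) {x1 f2 f3 f12 f13 g : A} (c : f3 * f2 = f2 * f3)
    (h21 : f2 * x1 = q • (x1 * f2) - q • f12) (h31 : f3 * x1 = q • (x1 * f3) - q • f13)
    (hg : g = f12 * f3 - q⁻¹ • (f3 * f12)) : g = f13 * f2 - q⁻¹ • (f2 * f13) := by
  have e := asc c x1
  simp only [sub_mul, mul_sub, smul_mul_assoc, mul_smul_comm, mul_assoc, c, h31, h21, asc c,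
    asc h31, asc h21] at e
  subst hg
  linear_combination (norm := skip) (q⁻¹ ^ 2) • e
  match_scalars <;> field_simp <;> ring

theorem g_x (hq : q ≠ 0) {x1 f3 f12 f13 g : A}
    (hg : g = f12 * f3 - q⁻¹ • (f3 * f12)) (h1 : f12 * x1 = q⁻¹ • (x1 * f12))
    (h3 : f3 * x1 = q • (x1 * f3) - q • f13) (c : f12 * f13 = f13 * f12) :
    g * x1 = x1 * g + (q⁻¹ - q) • (f13 * f12) := by
  subst hg
  simp only [sub_mul, mul_sub, smul_mul_assoc, mul_smul_comm, mul_assoc, c, h1, h3, asc c,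
    asc h1, asc h3]
  match_scalars <;> field_simp <;> ring

theorem f_g {f1 f3 f12 g : A} (hg : g = f12 * f3 - q⁻¹ • (f3 * f12))
    (h : f1 * f12 = q⁻¹ • (f12 * f1)) (c : f1 * f3 = f3 * f1) : f1 * g = q⁻¹ • (g * f1) := by
  subst hg
  simp only [sub_mul, mul_sub, smul_mul_assoc, mul_smul_comm, mul_assoc, c, h, asc c, asc h]
  module

theorem g_f {f2 f13 f12 g : A} (hg : g = f13 * f2 - q⁻¹ • (f2 * f13))
    (h : f2 * f12 = q⁻¹ • (f12 * f2)) (c : f13 * f12 = f12 * f13) : g * f12 = q⁻¹ • (f12 * g) := by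
  subst hg
  simp only [sub_mul, mul_sub, smul_mul_assoc, mul_smul_comm, mul_assoc, c, h, asc c, asc h]
  module

theorem g_f123 (hq : q ≠ 0) {f3 f12 f13 f23 f123 g : A} (hg : g = f12 * f3 - q⁻¹ • (f3 * f12))
    (h : f12 * f123 = q⁻¹ • (f123 * f12)) (h3 : f3 * f123 = f123 * f3 + (q⁻¹ - q) • (f23 * f13))
    (c1 : f12 * f13 = f13 * f12) (c2 : f12 * f23 = f23 * f12) :
    g * f123 = q⁻¹ • (f123 * g) - (q⁻¹ * (q - q⁻¹) ^ 2) • (f23 * (f13 * f12)) := by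
  subst hg
  simp only [sub_mul, mul_sub, add_mul, mul_add, smul_mul_assoc, mul_smul_comm, mul_assoc, c1, c2,
    h, h3, asc h, asc h3, asc c1, asc c2]
  match_scalars <;> field_simp <;> ring

theorem y_g (hq : q ≠ 0) {y f1 f2 f3 f12 g : A} (hg : g = f12 * f3 - q⁻¹ • (f3 * f12))
    (h12 : y * f12 = f12 * y + (q⁻¹ - q) • (f1 * f2)) (h3 : y * f3 = q⁻¹ • (f3 * y))
    (c1 : f3 * f1 = f1 * f3) (c2 : f3 * f2 = f2 * f3) :
    y * g = q⁻¹ • (g * y) - (q⁻¹ * (q - q⁻¹) ^ 2) • (f1 * (f2 * f3)) := by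
  subst hg
  simp only [sub_mul, mul_sub, add_mul, mul_add, smul_mul_assoc, mul_smul_comm, mul_assoc, c1, c2,
    h12, h3, asc h12, asc h3, asc c1, asc c2]
  match_scalars <;> field_simp <;> ring

theorem y_f123 (hq : q ≠ 0) {x3 y f1 f2 f3 f12 f13 f23 f123 g : A}
    (h12 : y * f12 = f12 * y + (q⁻¹ - q) • (f1 * f2))
    (h123 : f12 * x3 = q • (x3 * f12) - q • f123)
    (hy : y * x3 = q • (x3 * y) - q • f3)
    (h1 : f1 * x3 = q • (x3 * f1) - q • f13) (h2 : f2 * x3 = q • (x3 * f2) - q • f23)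
    (g1 : f1 * f23 = q • (f23 * f1) - q • g) (g2 : f2 * f13 = q • (f13 * f2) - q • g)
    (g3 : f3 * f12 = q • (f12 * f3) - q • g) :
    y * f123 = q • (f123 * y) + (2 * q ^ 2 - 1) • g
      + (1 - q ^ 2) • (f12 * f3 + f13 * f2 + f23 * f1) := by
  have e := asc h12 x3
  simp only [sub_mul, mul_sub, add_mul, mul_add, smul_mul_assoc, mul_smul_comm, mul_assoc, h12,
    h123, hy, h1, h2, g1, g2, g3, asc h12, asc h123, asc hy, asc h1, asc h2] at e
  linear_combination (norm := skip) (-q⁻¹) • e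
  match_scalars <;> field_simp <;> ring

end Basic

/-- The straightening rules of the PBW basis attached to the root vectors. -/
structure PBW {K A : Type*} [Field K] [Ring A] [Algebra K A] (q : K)
    (x1 x2 x3 f123 f23 f13 f12 g f1 f2 f3 y : A) : Prop where
  x1x2_ : x2 * x1 = x1 * x2
  f1f2_ : f2 * f1 = f1 * f2
  x1x3_ : x3 * x1 = x1 * x3
  f1f3_ : f3 * f1 = f1 * f3
  x2x3_ : x3 * x2 = x2 * x3
  f2f3_ : f3 * f2 = f2 * f3
  x1f123_ : f123 * x1 = q⁻¹ • (x1 * f123)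
  x1f23_ : f23 * x1 = q • (x1 * f23) - q • f123
  f123f23_ : f23 * f123 = q⁻¹ • (f123 * f23)
  x2f23_ : f23 * x2 = q⁻¹ • (x2 * f23)
  x3f23_ : f23 * x3 = q⁻¹ • (x3 * f23)
  x2f123_ : f123 * x2 = q⁻¹ • (x2 * f123)
  x2f13_ : f13 * x2 = q • (x2 * f13) - q • f123
  f123f13_ : f13 * f123 = q⁻¹ • (f123 * f13)
  x1f13_ : f13 * x1 = q⁻¹ • (x1 * f13)
  x3f13_ : f13 * x3 = q⁻¹ • (x3 * f13)
  x3f123_ : f123 * x3 = q⁻¹ • (x3 * f123)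
  x3f12_ : f12 * x3 = q • (x3 * f12) - q • f123
  f123f12_ : f12 * f123 = q⁻¹ • (f123 * f12)
  x1f12_ : f12 * x1 = q⁻¹ • (x1 * f12)
  x2f12_ : f12 * x2 = q⁻¹ • (x2 * f12)
  f23f13_ : f13 * f23 = f23 * f13
  f23f12_ : f12 * f23 = f23 * f12
  f13f12_ : f12 * f13 = f13 * f12
  x1g_ : g * x1 = x1 * g + (q⁻¹ - q) • (f13 * f12)
  f23g_ : g * f23 = q⁻¹ • (f23 * g)
  f1g_ : f1 * g = q⁻¹ • (g * f1)
  x1f1_ : f1 * x1 = q⁻¹ • (x1 * f1)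
  x2f1_ : f1 * x2 = q • (x2 * f1) - q • f12
  x3f1_ : f1 * x3 = q • (x3 * f1) - q • f13
  f12f1_ : f1 * f12 = q⁻¹ • (f12 * f1)
  f13f1_ : f1 * f13 = q⁻¹ • (f13 * f1)
  f123f1_ : f1 * f123 = f123 * f1 + (q⁻¹ - q) • (f13 * f12)
  f23f1_ : f1 * f23 = q • (f23 * f1) - q • g
  x1y_ : y * x1 = q • (x1 * y) - q • f1
  f23y_ : y * f23 = f23 * y + (q⁻¹ - q) • (f2 * f3)
  f1y_ : y * f1 = q⁻¹ • (f1 * y)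
  x2g_ : g * x2 = x2 * g + (q⁻¹ - q) • (f23 * f12)
  f13g_ : g * f13 = q⁻¹ • (f13 * g)
  f2g_ : f2 * g = q⁻¹ • (g * f2)
  x2f2_ : f2 * x2 = q⁻¹ • (x2 * f2)
  x1f2_ : f2 * x1 = q • (x1 * f2) - q • f12
  x3f2_ : f2 * x3 = q • (x3 * f2) - q • f23
  f12f2_ : f2 * f12 = q⁻¹ • (f12 * f2)
  f23f2_ : f2 * f23 = q⁻¹ • (f23 * f2)
  f123f2_ : f2 * f123 = f123 * f2 + (q⁻¹ - q) • (f23 * f12)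
  f13f2_ : f2 * f13 = q • (f13 * f2) - q • g
  x2y_ : y * x2 = q • (x2 * y) - q • f2
  f13y_ : y * f13 = f13 * y + (q⁻¹ - q) • (f1 * f3)
  f2y_ : y * f2 = q⁻¹ • (f2 * y)
  x3g_ : g * x3 = x3 * g + (q⁻¹ - q) • (f23 * f13)
  f12g_ : g * f12 = q⁻¹ • (f12 * g)
  f3g_ : f3 * g = q⁻¹ • (g * f3)
  x3f3_ : f3 * x3 = q⁻¹ • (x3 * f3)
  x1f3_ : f3 * x1 = q • (x1 * f3) - q • f13
  x2f3_ : f3 * x2 = q • (x2 * f3) - q • f23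
  f13f3_ : f3 * f13 = q⁻¹ • (f13 * f3)
  f23f3_ : f3 * f23 = q⁻¹ • (f23 * f3)
  f123f3_ : f3 * f123 = f123 * f3 + (q⁻¹ - q) • (f23 * f13)
  f12f3_ : f3 * f12 = q • (f12 * f3) - q • g
  x3y_ : y * x3 = q • (x3 * y) - q • f3
  f12y_ : y * f12 = f12 * y + (q⁻¹ - q) • (f1 * f2)
  f3y_ : y * f3 = q⁻¹ • (f3 * y)
  f123g_ : g * f123 = q⁻¹ • (f123 * g) - (q⁻¹ * (q - q⁻¹) ^ 2) • (f23 * (f13 * f12))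
  f123y_ : y * f123 = q • (f123 * y) + (2 * q ^ 2 - 1) • g
    + (1 - q ^ 2) • (f12 * f3 + f13 * f2 + f23 * f1)
  gy_ : y * g = q⁻¹ • (g * y) - (q⁻¹ * (q - q⁻¹) ^ 2) • (f1 * (f2 * f3))

theorem PBW.rules {K A : Type*} [Field K] [Ring A] [Algebra K A] {q : K}
    {x1 x2 x3 f123 f23 f13 f12 g f1 f2 f3 y : A}
    (h : PBW q x1 x2 x3 f123 f23 f13 f12 g f1 f2 f3 y) :
    (x2 * x1 = x1 * x2) ∧
    (f2 * f1 = f1 * f2) ∧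
    (x3 * x1 = x1 * x3) ∧
    (f3 * f1 = f1 * f3) ∧
    (x3 * x2 = x2 * x3) ∧
    (f3 * f2 = f2 * f3) ∧
    (f123 * x1 = q⁻¹ • (x1 * f123)) ∧
    (f23 * x1 = q • (x1 * f23) - q • f123) ∧
    (f23 * f123 = q⁻¹ • (f123 * f23)) ∧
    (f23 * x2 = q⁻¹ • (x2 * f23)) ∧
    (f23 * x3 = q⁻¹ • (x3 * f23)) ∧
    (f123 * x2 = q⁻¹ • (x2 * f123)) ∧
    (f13 * x2 = q • (x2 * f13) - q • f123) ∧
    (f13 * f123 = q⁻¹ • (f123 * f13)) ∧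
    (f13 * x1 = q⁻¹ • (x1 * f13)) ∧
    (f13 * x3 = q⁻¹ • (x3 * f13)) ∧
    (f123 * x3 = q⁻¹ • (x3 * f123)) ∧
    (f12 * x3 = q • (x3 * f12) - q • f123) ∧
    (f12 * f123 = q⁻¹ • (f123 * f12)) ∧
    (f12 * x1 = q⁻¹ • (x1 * f12)) ∧
    (f12 * x2 = q⁻¹ • (x2 * f12)) ∧
    (f13 * f23 = f23 * f13) ∧
    (f12 * f23 = f23 * f12) ∧
    (f12 * f13 = f13 * f12) ∧
    (g * x1 = x1 * g + (q⁻¹ - q) • (f13 * f12)) ∧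
    (g * f23 = q⁻¹ • (f23 * g)) ∧
    (f1 * g = q⁻¹ • (g * f1)) ∧
    (f1 * x1 = q⁻¹ • (x1 * f1)) ∧
    (f1 * x2 = q • (x2 * f1) - q • f12) ∧
    (f1 * x3 = q • (x3 * f1) - q • f13) ∧
    (f1 * f12 = q⁻¹ • (f12 * f1)) ∧
    (f1 * f13 = q⁻¹ • (f13 * f1)) ∧
    (f1 * f123 = f123 * f1 + (q⁻¹ - q) • (f13 * f12)) ∧
    (f1 * f23 = q • (f23 * f1) - q • g) ∧
    (y * x1 = q • (x1 * y) - q • f1) ∧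
    (y * f23 = f23 * y + (q⁻¹ - q) • (f2 * f3)) ∧
    (y * f1 = q⁻¹ • (f1 * y)) ∧
    (g * x2 = x2 * g + (q⁻¹ - q) • (f23 * f12)) ∧
    (g * f13 = q⁻¹ • (f13 * g)) ∧
    (f2 * g = q⁻¹ • (g * f2)) ∧
    (f2 * x2 = q⁻¹ • (x2 * f2)) ∧
    (f2 * x1 = q • (x1 * f2) - q • f12) ∧
    (f2 * x3 = q • (x3 * f2) - q • f23) ∧
    (f2 * f12 = q⁻¹ • (f12 * f2)) ∧
    (f2 * f23 = q⁻¹ • (f23 * f2)) ∧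
    (f2 * f123 = f123 * f2 + (q⁻¹ - q) • (f23 * f12)) ∧
    (f2 * f13 = q • (f13 * f2) - q • g) ∧
    (y * x2 = q • (x2 * y) - q • f2) ∧
    (y * f13 = f13 * y + (q⁻¹ - q) • (f1 * f3)) ∧
    (y * f2 = q⁻¹ • (f2 * y)) ∧
    (g * x3 = x3 * g + (q⁻¹ - q) • (f23 * f13)) ∧
    (g * f12 = q⁻¹ • (f12 * g)) ∧
    (f3 * g = q⁻¹ • (g * f3)) ∧
    (f3 * x3 = q⁻¹ • (x3 * f3)) ∧
    (f3 * x1 = q • (x1 * f3) - q • f13) ∧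
    (f3 * x2 = q • (x2 * f3) - q • f23) ∧
    (f3 * f13 = q⁻¹ • (f13 * f3)) ∧
    (f3 * f23 = q⁻¹ • (f23 * f3)) ∧
    (f3 * f123 = f123 * f3 + (q⁻¹ - q) • (f23 * f13)) ∧
    (f3 * f12 = q • (f12 * f3) - q • g) ∧
    (y * x3 = q • (x3 * y) - q • f3) ∧
    (y * f12 = f12 * y + (q⁻¹ - q) • (f1 * f2)) ∧
    (y * f3 = q⁻¹ • (f3 * y)) ∧
    (g * f123 = q⁻¹ • (f123 * g) - (q⁻¹ * (q - q⁻¹) ^ 2) • (f23 * (f13 * f12))) ∧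
    (y * f123 = q • (f123 * y) + (2 * q ^ 2 - 1) • g + (1 - q ^ 2) • (f12 * f3 + f13 * f2 + f23 * f1)) ∧
    (y * g = q⁻¹ • (g * y) - (q⁻¹ * (q - q⁻¹) ^ 2) • (f1 * (f2 * f3))) := by
  obtain ⟨a0, a1, a2, a3, a4, a5, a6, a7, a8, a9,
    a10, a11, a12, a13, a14, a15, a16, a17, a18, a19,
    a20, a21, a22, a23, a24, a25, a26, a27, a28, a29,
    a30, a31, a32, a33, a34, a35, a36, a37, a38, a39,
    a40, a41, a42, a43, a44, a45, a46, a47, a48, a49,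
    a50, a51, a52, a53, a54, a55, a56, a57, a58, a59,
    a60, a61, a62, a63, a64, a65⟩ := h
  exact ⟨a0, a1, a2, a3, a4, a5, a6, a7, a8, a9,
    a10, a11, a12, a13, a14, a15, a16, a17, a18, a19,
    a20, a21, a22, a23, a24, a25, a26, a27, a28, a29,
    a30, a31, a32, a33, a34, a35, a36, a37, a38, a39,
    a40, a41, a42, a43, a44, a45, a46, a47, a48, a49,
    a50, a51, a52, a53, a54, a55, a56, a57, a58, a59,
    a60, a61, a62, a63, a64, a65⟩

theorem PBW.rules_assoc {K A : Type*} [Field K] [Ring A] [Algebra K A] {q : K}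
    {x1 x2 x3 f123 f23 f13 f12 g f1 f2 f3 y : A}
    (h : PBW q x1 x2 x3 f123 f23 f13 f12 g f1 f2 f3 y) (t : A) :
    (x2 * (x1 * t) = x1 * (x2 * t)) ∧
    (f2 * (f1 * t) = f1 * (f2 * t)) ∧
    (x3 * (x1 * t) = x1 * (x3 * t)) ∧
    (f3 * (f1 * t) = f1 * (f3 * t)) ∧
    (x3 * (x2 * t) = x2 * (x3 * t)) ∧
    (f3 * (f2 * t) = f2 * (f3 * t)) ∧
    (f123 * (x1 * t) = q⁻¹ • (x1 * (f123 * t))) ∧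
    (f23 * (x1 * t) = q • (x1 * (f23 * t)) - q • (f123 * t)) ∧
    (f23 * (f123 * t) = q⁻¹ • (f123 * (f23 * t))) ∧
    (f23 * (x2 * t) = q⁻¹ • (x2 * (f23 * t))) ∧
    (f23 * (x3 * t) = q⁻¹ • (x3 * (f23 * t))) ∧
    (f123 * (x2 * t) = q⁻¹ • (x2 * (f123 * t))) ∧
    (f13 * (x2 * t) = q • (x2 * (f13 * t)) - q • (f123 * t)) ∧
    (f13 * (f123 * t) = q⁻¹ • (f123 * (f13 * t))) ∧
    (f13 * (x1 * t) = q⁻¹ • (x1 * (f13 * t))) ∧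
    (f13 * (x3 * t) = q⁻¹ • (x3 * (f13 * t))) ∧
    (f123 * (x3 * t) = q⁻¹ • (x3 * (f123 * t))) ∧
    (f12 * (x3 * t) = q • (x3 * (f12 * t)) - q • (f123 * t)) ∧
    (f12 * (f123 * t) = q⁻¹ • (f123 * (f12 * t))) ∧
    (f12 * (x1 * t) = q⁻¹ • (x1 * (f12 * t))) ∧
    (f12 * (x2 * t) = q⁻¹ • (x2 * (f12 * t))) ∧
    (f13 * (f23 * t) = f23 * (f13 * t)) ∧
    (f12 * (f23 * t) = f23 * (f12 * t)) ∧
    (f12 * (f13 * t) = f13 * (f12 * t)) ∧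
    (g * (x1 * t) = x1 * (g * t) + (q⁻¹ - q) • (f13 * (f12 * t))) ∧
    (g * (f23 * t) = q⁻¹ • (f23 * (g * t))) ∧
    (f1 * (g * t) = q⁻¹ • (g * (f1 * t))) ∧
    (f1 * (x1 * t) = q⁻¹ • (x1 * (f1 * t))) ∧
    (f1 * (x2 * t) = q • (x2 * (f1 * t)) - q • (f12 * t)) ∧
    (f1 * (x3 * t) = q • (x3 * (f1 * t)) - q • (f13 * t)) ∧
    (f1 * (f12 * t) = q⁻¹ • (f12 * (f1 * t))) ∧
    (f1 * (f13 * t) = q⁻¹ • (f13 * (f1 * t))) ∧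
    (f1 * (f123 * t) = f123 * (f1 * t) + (q⁻¹ - q) • (f13 * (f12 * t))) ∧
    (f1 * (f23 * t) = q • (f23 * (f1 * t)) - q • (g * t)) ∧
    (y * (x1 * t) = q • (x1 * (y * t)) - q • (f1 * t)) ∧
    (y * (f23 * t) = f23 * (y * t) + (q⁻¹ - q) • (f2 * (f3 * t))) ∧
    (y * (f1 * t) = q⁻¹ • (f1 * (y * t))) ∧
    (g * (x2 * t) = x2 * (g * t) + (q⁻¹ - q) • (f23 * (f12 * t))) ∧
    (g * (f13 * t) = q⁻¹ • (f13 * (g * t))) ∧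
    (f2 * (g * t) = q⁻¹ • (g * (f2 * t))) ∧
    (f2 * (x2 * t) = q⁻¹ • (x2 * (f2 * t))) ∧
    (f2 * (x1 * t) = q • (x1 * (f2 * t)) - q • (f12 * t)) ∧
    (f2 * (x3 * t) = q • (x3 * (f2 * t)) - q • (f23 * t)) ∧
    (f2 * (f12 * t) = q⁻¹ • (f12 * (f2 * t))) ∧
    (f2 * (f23 * t) = q⁻¹ • (f23 * (f2 * t))) ∧
    (f2 * (f123 * t) = f123 * (f2 * t) + (q⁻¹ - q) • (f23 * (f12 * t))) ∧
    (f2 * (f13 * t) = q • (f13 * (f2 * t)) - q • (g * t)) ∧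
    (y * (x2 * t) = q • (x2 * (y * t)) - q • (f2 * t)) ∧
    (y * (f13 * t) = f13 * (y * t) + (q⁻¹ - q) • (f1 * (f3 * t))) ∧
    (y * (f2 * t) = q⁻¹ • (f2 * (y * t))) ∧
    (g * (x3 * t) = x3 * (g * t) + (q⁻¹ - q) • (f23 * (f13 * t))) ∧
    (g * (f12 * t) = q⁻¹ • (f12 * (g * t))) ∧
    (f3 * (g * t) = q⁻¹ • (g * (f3 * t))) ∧
    (f3 * (x3 * t) = q⁻¹ • (x3 * (f3 * t))) ∧
    (f3 * (x1 * t) = q • (x1 * (f3 * t)) - q • (f13 * t)) ∧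
    (f3 * (x2 * t) = q • (x2 * (f3 * t)) - q • (f23 * t)) ∧
    (f3 * (f13 * t) = q⁻¹ • (f13 * (f3 * t))) ∧
    (f3 * (f23 * t) = q⁻¹ • (f23 * (f3 * t))) ∧
    (f3 * (f123 * t) = f123 * (f3 * t) + (q⁻¹ - q) • (f23 * (f13 * t))) ∧
    (f3 * (f12 * t) = q • (f12 * (f3 * t)) - q • (g * t)) ∧
    (y * (x3 * t) = q • (x3 * (y * t)) - q • (f3 * t)) ∧
    (y * (f12 * t) = f12 * (y * t) + (q⁻¹ - q) • (f1 * (f2 * t))) ∧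
    (y * (f3 * t) = q⁻¹ • (f3 * (y * t))) ∧
    (g * (f123 * t) = q⁻¹ • (f123 * (g * t)) - (q⁻¹ * (q - q⁻¹) ^ 2) • (f23 * (f13 * (f12 * t)))) ∧
    (y * (f123 * t) = q • (f123 * (y * t)) + (2 * q ^ 2 - 1) • (g * t) + (1 - q ^ 2) • (f12 * (f3 * t) + f13 * (f2 * t) + f23 * (f1 * t))) ∧
    (y * (g * t) = q⁻¹ • (g * (y * t)) - (q⁻¹ * (q - q⁻¹) ^ 2) • (f1 * (f2 * (f3 * t)))) := by
  refine ⟨?_, ?_, ?_, ?_, ?_, ?_, ?_, ?_, ?_, ?_, ?_, ?_, ?_, ?_, ?_, ?_, ?_, ?_, ?_, ?_,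
    ?_, ?_, ?_, ?_, ?_, ?_, ?_, ?_, ?_, ?_, ?_, ?_, ?_, ?_, ?_, ?_, ?_, ?_, ?_, ?_,
    ?_, ?_, ?_, ?_, ?_, ?_, ?_, ?_, ?_, ?_, ?_, ?_, ?_, ?_, ?_, ?_, ?_, ?_, ?_, ?_,
    ?_, ?_, ?_, ?_, ?_, ?_⟩ <;>
  simp only [← mul_assoc, h.rules, add_mul, sub_mul, smul_mul_assoc]

theorem PBW.build {K A : Type*} [Field K] [Ring A] [Algebra K A] {q : K} (hq : q ≠ 0)
    (hq2 : q ^ 2 + 1 ≠ 0) {x1 x2 x3 f123 f23 f13 f12 g f1 f2 f3 y : A}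
    (c12 : x2 * x1 = x1 * x2) (c13 : x3 * x1 = x1 * x3) (c23 : x3 * x2 = x2 * x3)
    (s1 : x1 * x1 * y + y * x1 * x1 = (q + q⁻¹) • (x1 * y * x1))
    (s2 : x2 * x2 * y + y * x2 * x2 = (q + q⁻¹) • (x2 * y * x2))
    (s3 : x3 * x3 * y + y * x3 * x3 = (q + q⁻¹) • (x3 * y * x3))
    (t1 : y * y * x1 + x1 * y * y = (q + q⁻¹) • (y * x1 * y))
    (t2 : y * y * x2 + x2 * y * y = (q + q⁻¹) • (y * x2 * y))
    (t3 : y * y * x3 + x3 * y * y = (q + q⁻¹) • (y * x3 * y))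
    (d1 : f1 = x1 * y - q⁻¹ • (y * x1)) (d2 : f2 = x2 * y - q⁻¹ • (y * x2))
    (d3 : f3 = x3 * y - q⁻¹ • (y * x3)) (d12 : f12 = x1 * f2 - q⁻¹ • (f2 * x1))
    (d13 : f13 = x1 * f3 - q⁻¹ • (f3 * x1)) (d23 : f23 = x2 * f3 - q⁻¹ • (f3 * x2))
    (d123 : f123 = x1 * f23 - q⁻¹ • (f23 * x1)) (dg : g = f12 * f3 - q⁻¹ • (f3 * f12)) :
    PBW q x1 x2 x3 f123 f23 f13 f12 g f1 f2 f3 y := by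
  have d21 := def_symm c12 d1 d2 d12
  have d31 := def_symm c13 d1 d3 d13
  have d32 := def_symm c23 d2 d3 d23
  have d213 := def_symm c12 d13 d23 d123
  have d312 := def_symm c13 d12 d32 d123
  -- the rules that are just definitions
  have y1 := def_rule hq d1
  have y2 := def_rule hq d2
  have y3 := def_rule hq d3
  have r12 := def_rule hq d21
  have r21 := def_rule hq d12
  have r13 := def_rule hq d31
  have r31 := def_rule hq d13
  have r23 := def_rule hq d32
  have r32 := def_rule hq d23
  have r123 := def_rule hq d312
  have r132 := def_rule hq d213
  have r231 := def_rule hq d123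
  -- Serre relations
  have x11 := serre_x hq d1 s1
  have x22 := serre_x hq d2 s2
  have x33 := serre_x hq d3 s3
  have yf1 := serre_y hq d1 t1
  have yf2 := serre_y hq d2 t2
  have yf3 := serre_y hq d3 t3
  -- `x_i` against the `f_ij` and `f_123`
  have x112 := qcomm_x c12 d21 x11
  have x113 := qcomm_x c13 d31 x11
  have x212 := qcomm_x c12.symm d12 x22
  have x223 := qcomm_x c23 d32 x22
  have x313 := qcomm_x c13.symm d13 x33
  have x323 := qcomm_x c23.symm d23 x33
  have x1123 := qcomm_x c12 d213 x113
  have x2123 := qcomm_x c12.symm d123 x223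
  have x3123 := qcomm_x c13.symm d123 x323
  -- overlaps
  obtain ⟨f21, yf12⟩ := overlap hq hq2 yf1 yf2 y1 y2 r12 r21
  obtain ⟨f31, yf13⟩ := overlap hq hq2 yf1 yf3 y1 y3 r13 r31
  obtain ⟨f32, yf23⟩ := overlap hq hq2 yf2 yf3 y2 y3 r23 r32
  have k1 := qcomm_f hq f21 x11 r21
  have k2 := qcomm_f hq f31 x11 r31
  have k3 := qcomm_f hq f21.symm x22 r12
  have k4 := qcomm_f hq f32 x22 r32
  have k5 := qcomm_f hq f31.symm x33 r13
  have k6 := qcomm_f hq f32.symm x33 r23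
  obtain ⟨m1, n1⟩ := overlap hq hq2 k2 k1 r13 r12 r132 r123
  obtain ⟨m2, n2⟩ := overlap hq hq2 k4 k3 r23 r21 r231 r123
  obtain ⟨m3, n3⟩ := overlap hq hq2 k6 k5 r32 r31 r231 r132
  have l12 := qcomm_f hq m1.symm x212 r132
  have l13 := qcomm_f hq m1 x313 r123
  have l23 := qcomm_f hq m2 x323 r123
  have dg2 := g_symm hq f32 r21 r31 dg
  have dg1 := g_symm hq f31 r12 r32 dg
  have g1 := def_rule hq dg1
  have g2 := def_rule hq dg2
  have g3 := def_rule hq dg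
  have gx1 := g_x hq dg x112 r31 m1
  have gx2 := g_x hq dg x212 r32 m2
  have gx3 := g_x hq dg2 x313 r23 m3
  have fg1 := f_g dg k1 f31.symm
  have fg2 := f_g dg k3 f32.symm
  have fg3 := f_g dg2 k5 f32
  have gf12 := g_f dg2 k3 m1.symm
  have gf13 := g_f dg k5 m1
  have gf23 := g_f dg k6 m2
  have gf123 := g_f123 hq dg l12 n3 m1 m2
  have yg := y_g hq dg yf12 yf3 f31 f32
  have yf123 := y_f123 hq yf12 r123 y3 r13 r23 g1 g2 g3
  constructor <;> assumption
/-- The deformed commutator. -/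
def qc {K A : Type*} [Field K] [Ring A] [Algebra K A] (a b : A) (v : K) : A := a * b - v • (b * a)

section Main
variable {K A : Type*} [Field K] [Ring A] [Algebra K A] {q : K}
  {x1 x2 x3 f123 f23 f13 f12 g f1 f2 f3 y : A}

/-- Normal form of `z₁`. -/
def nz1 (q : K) (x1 x2 x3 f123 f23 f13 f12 f1 f2 f3 : A) : A :=
  (-3 / (q - q⁻¹) ^ 2) • f123 - (x1 * f23 + x2 * f13 + x3 * f12)
    + (x2 * (x3 * f1) + x1 * (x3 * f2) + x1 * (x2 * f3))

/-- Normal form of `z₂`. -/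
def nz2 (q : K) (x1 x2 x3 f123 f23 f13 f12 f1 f2 f3 : A) : A :=
  (3 * q ^ 3 / (q - q⁻¹) ^ 2) • f123 + (q - 3 * q ^ 2 / (q - q⁻¹)) • (x1 * f23 + x2 * f13 + x3 * f12)
    + (q + q⁻¹) • (x2 * (x3 * f1) + x1 * (x3 * f2) + x1 * (x2 * f3))

theorem z1_eq (hq : q ≠ 0) (hq1 : q ^ 2 - 1 ≠ 0)
    (h : PBW q x1 x2 x3 f123 f23 f13 f12 g f1 f2 f3 y) :
    qc (x1 * x2 * x3) y (q⁻¹ ^ 3) - ((q ^ 2 + 1 + q⁻¹ ^ 2) / (q - q⁻¹) ^ 2) •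
      qc x1 (qc x2 (qc x3 y q⁻¹) q⁻¹) q⁻¹ = nz1 q x1 x2 x3 f123 f23 f13 f12 f1 f2 f3 := by
  have hd : q - q⁻¹ = (q ^ 2 - 1) / q := by field_simp
  rw [hd]
  simp only [qc, nz1, h.rules, h.rules_assoc, add_mul, sub_mul, mul_add, mul_sub, smul_mul_assoc,
    mul_smul_comm, mul_assoc, smul_add, smul_sub, inv_smul_smul₀ hq, smul_inv_smul₀ hq]
  match_scalars <;> field_simp <;> ring

theorem z2_eq (hq : q ≠ 0) (hq1 : q ^ 2 - 1 ≠ 0)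
    (h : PBW q x1 x2 x3 f123 f23 f13 f12 g f1 f2 f3 y) :
    qc y (x1 * x2 * x3) (q⁻¹ ^ 3) - ((q ^ 2 + 1 + q⁻¹ ^ 2) / (q - q⁻¹) ^ 2) •
      qc (qc (qc y x1 q⁻¹) x2 q⁻¹) x3 q⁻¹ = nz2 q x1 x2 x3 f123 f23 f13 f12 f1 f2 f3 := by
  have hd : q - q⁻¹ = (q ^ 2 - 1) / q := by field_simp
  rw [hd]
  simp only [qc, nz2, h.rules, h.rules_assoc, add_mul, sub_mul, mul_add, mul_sub, smul_mul_assoc,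
    mul_smul_comm, mul_assoc, smul_add, smul_sub, inv_smul_smul₀ hq, smul_inv_smul₀ hq]
  match_scalars <;> field_simp <;> ring

theorem id1 (hq : q ≠ 0) (h : PBW q x1 x2 x3 f123 f23 f13 f12 g f1 f2 f3 y) :
    qc y (qc y (qc y (qc y (x1 * x2 * x3) (q⁻¹ ^ 3)) q⁻¹) q) (q ^ 3) = 0 := by
  obtain ⟨p1, hp1⟩ : ∃ p1, p1 = -f123 + (x1 * f23 + x2 * f13 + x3 * f12)
      - (x2 * (x3 * f1) + x1 * (x3 * f2) + x1 * (x2 * f3)) := ⟨_, rfl⟩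
  obtain ⟨p2, hp2⟩ : ∃ p2, p2 = (1 + q ^ 2) • (g - (f12 * f3 + f13 * f2 + f23 * f1)
      + (x3 * (f1 * f2) + x2 * (f1 * f3) + x1 * (f2 * f3))) := ⟨_, rfl⟩
  obtain ⟨p3, hp3⟩ : ∃ p3, p3 = (-(q⁻¹ ^ 3 * (1 + q ^ 2) * (1 + q ^ 2 + q ^ 4))) • (f1 * (f2 * f3)) :=
    ⟨_, rfl⟩
  obtain ⟨w, hw⟩ : ∃ w, w = x1 * x2 * x3 := ⟨_, rfl⟩
  have e0 : y * w = q ^ 3 • (w * y) + q ^ 3 • p1 := by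
    subst hw hp1
    simp only [h.rules, h.rules_assoc, add_mul, sub_mul, mul_add, mul_sub, smul_mul_assoc,
      mul_smul_comm, mul_assoc, smul_add, smul_sub, inv_smul_smul₀ hq, smul_inv_smul₀ hq]
    match_scalars <;> field_simp <;> ring
  have e1 : y * p1 = q • (p1 * y) + p2 := by
    subst hp1 hp2
    simp only [h.rules, h.rules_assoc, add_mul, sub_mul, neg_mul, mul_neg, mul_add, mul_sub,
      smul_mul_assoc, mul_smul_comm, mul_assoc, smul_add, smul_sub, inv_smul_smul₀ hq,
      smul_inv_smul₀ hq]
    match_scalars <;> field_simp <;> ring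
  have e2 : y * p2 = q⁻¹ • (p2 * y) + p3 := by
    subst hp2 hp3
    simp only [h.rules, h.rules_assoc, add_mul, sub_mul, mul_add, mul_sub, smul_mul_assoc,
      mul_smul_comm, mul_assoc, smul_add, smul_sub, inv_smul_smul₀ hq, smul_inv_smul₀ hq]
    match_scalars <;> field_simp <;> ring
  have e3 : y * p3 = q⁻¹ ^ 3 • (p3 * y) := by
    subst hp3
    simp only [h.rules, h.rules_assoc, smul_mul_assoc, mul_smul_comm, mul_assoc]
    match_scalars <;> field_simp
  rw [← hw]
  simp only [qc, mul_sub, sub_mul, mul_add, add_mul, smul_mul_assoc, mul_smul_comm, mul_assoc,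
    e0, e1, e2, e3, asc e0, asc e1, asc e2, asc e3]
  match_scalars <;> field_simp <;> ring

set_option maxHeartbeats 4000000 in
theorem id2a (hq : q ≠ 0) (hq1 : q ^ 2 - 1 ≠ 0)
    (h : PBW q x1 x2 x3 f123 f23 f13 f12 g f1 f2 f3 y) {w z1 z2 : A} (hw : w = x1 * x2 * x3)
    (h1 : z1 = nz1 q x1 x2 x3 f123 f23 f13 f12 f1 f2 f3)
    (h2 : z2 = nz2 q x1 x2 x3 f123 f23 f13 f12 f1 f2 f3) :
    qc w (qc w y (q⁻¹ ^ 3)) (q ^ 3) = qc w z1 (q ^ 3) := by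
  have hd : q - q⁻¹ = (q ^ 2 - 1) / q := by field_simp
  subst hw h1 h2
  simp only [qc, nz1, nz2, hd, h.rules, h.rules_assoc, add_mul, sub_mul, mul_add, mul_sub,
    smul_mul_assoc, mul_smul_comm, mul_assoc, smul_add, smul_sub, inv_smul_smul₀ hq,
    smul_inv_smul₀ hq]
  match_scalars <;> field_simp <;> ring

set_option maxHeartbeats 4000000 in
theorem id2b (hq : q ≠ 0) (hq1 : q ^ 2 - 1 ≠ 0)
    (h : PBW q x1 x2 x3 f123 f23 f13 f12 g f1 f2 f3 y) {w z1 z2 : A} (hw : w = x1 * x2 * x3)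
    (h1 : z1 = nz1 q x1 x2 x3 f123 f23 f13 f12 f1 f2 f3)
    (h2 : z2 = nz2 q x1 x2 x3 f123 f23 f13 f12 f1 f2 f3) :
    qc w z1 (q ^ 3) = qc z2 w (q ^ 3) := by
  have hd : q - q⁻¹ = (q ^ 2 - 1) / q := by field_simp
  subst hw h1 h2
  simp only [qc, nz1, nz2, hd, h.rules, h.rules_assoc, add_mul, sub_mul, mul_add, mul_sub,
    smul_mul_assoc, mul_smul_comm, mul_assoc, smul_add, smul_sub, inv_smul_smul₀ hq,
    smul_inv_smul₀ hq]
  match_scalars <;> field_simp <;> ring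

set_option maxHeartbeats 4000000 in
theorem id2c (hq : q ≠ 0) (hq1 : q ^ 2 - 1 ≠ 0)
    (h : PBW q x1 x2 x3 f123 f23 f13 f12 g f1 f2 f3 y) {w z1 z2 : A} (hw : w = x1 * x2 * x3)
    (h1 : z1 = nz1 q x1 x2 x3 f123 f23 f13 f12 f1 f2 f3)
    (h2 : z2 = nz2 q x1 x2 x3 f123 f23 f13 f12 f1 f2 f3) :
    qc z2 w (q ^ 3) = q • (qc z1 w q + qc w z2 q) := by
  have hd : q - q⁻¹ = (q ^ 2 - 1) / q := by field_simp
  subst hw h1 h2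
  simp only [qc, nz1, nz2, hd, h.rules, h.rules_assoc, add_mul, sub_mul, mul_add, mul_sub,
    smul_mul_assoc, mul_smul_comm, mul_assoc, smul_add, smul_sub, inv_smul_smul₀ hq,
    smul_inv_smul₀ hq]
  match_scalars <;> field_simp <;> ring

set_option maxHeartbeats 4000000 in
theorem id4a (hq : q ≠ 0) (hq1 : q ^ 2 - 1 ≠ 0)
    (h : PBW q x1 x2 x3 f123 f23 f13 f12 g f1 f2 f3 y) {w z1 z2 : A} (hw : w = x1 * x2 * x3)
    (h1 : z1 = nz1 q x1 x2 x3 f123 f23 f13 f12 f1 f2 f3)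
    (h2 : z2 = nz2 q x1 x2 x3 f123 f23 f13 f12 f1 f2 f3) :
    qc z1 (qc y w q) (1 : K) = qc (qc w y q) z2 (1 : K) := by
  have hd : q - q⁻¹ = (q ^ 2 - 1) / q := by field_simp
  subst hw h1 h2
  simp only [qc, nz1, nz2, hd, h.rules, h.rules_assoc, add_mul, sub_mul, mul_add, mul_sub,
    smul_mul_assoc, mul_smul_comm, mul_assoc, smul_add, smul_sub, inv_smul_smul₀ hq,
    smul_inv_smul₀ hq]
  match_scalars <;> field_simp <;> ring

/-- Normal form of `[w,u]_{q⁻³}`. -/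
def nwu (x1 x2 x3 f123 f23 f13 f12 f1 f2 f3 : A) : A :=
  f123 - (x1 * f23 + x2 * f13 + x3 * f12)
    + (x2 * (x3 * f1) + x1 * (x3 * f2) + x1 * (x2 * f3))

theorem wu_eq (hq : q ≠ 0) (h : PBW q x1 x2 x3 f123 f23 f13 f12 g f1 f2 f3 y) :
    qc (x1 * x2 * x3) y (q⁻¹ ^ 3) = nwu x1 x2 x3 f123 f23 f13 f12 f1 f2 f3 := by
  simp only [qc, nwu, h.rules, h.rules_assoc, add_mul, sub_mul, mul_add, mul_sub, smul_mul_assoc,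
    mul_smul_comm, mul_assoc, smul_add, smul_sub, inv_smul_smul₀ hq, smul_inv_smul₀ hq]
  match_scalars <;> field_simp <;> ring

/-- Normal form of `[z₁,u]_{q⁻¹}`. -/
def nA (q : K) (x1 x2 x3 f23 f13 f12 g f1 f2 f3 : A) : A :=
  (-3 / (q - q⁻¹) ^ 2 * (q⁻¹ - 2 * q) + 3 * q) • g
    + (-3 / (q - q⁻¹) - 2 * q) • (f12 * f3 + f13 * f2 + f23 * f1)
    + (q + q⁻¹) • (x3 * (f1 * f2) + x2 * (f1 * f3) + x1 * (f2 * f3))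

/-- Normal form of `[z₂,u]_{q⁻¹}`. -/
def nB (q : K) (x1 x2 x3 f23 f13 f12 g f1 f2 f3 : A) : A :=
  (3 * q ^ 3 / (q - q⁻¹) ^ 2 * (q⁻¹ - 2 * q) - 3 * q * (q - 3 * q ^ 2 / (q - q⁻¹))) • g
    + (3 * q ^ 3 / (q - q⁻¹) + q * (q - 3 * q ^ 2 / (q - q⁻¹)) - q * (q + q⁻¹)) •
      (f12 * f3 + f13 * f2 + f23 * f1)
    + ((q - q⁻¹) * q - 3 * q ^ 2 + 2 * q * (q + q⁻¹)) •
      (x3 * (f1 * f2) + x2 * (f1 * f3) + x1 * (f2 * f3))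

set_option maxHeartbeats 4000000 in
theorem A_eq (hq : q ≠ 0) (hq1 : q ^ 2 - 1 ≠ 0)
    (h : PBW q x1 x2 x3 f123 f23 f13 f12 g f1 f2 f3 y) {z1 z2 : A}
    (h1 : z1 = nz1 q x1 x2 x3 f123 f23 f13 f12 f1 f2 f3)
    (h2 : z2 = nz2 q x1 x2 x3 f123 f23 f13 f12 f1 f2 f3) :
    qc z1 y q⁻¹ = nA q x1 x2 x3 f23 f13 f12 g f1 f2 f3 := by
  have hd : q - q⁻¹ = (q ^ 2 - 1) / q := by field_simp
  subst h1 h2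
  simp only [qc, nz1, nA, hd, h.rules, h.rules_assoc, add_mul, sub_mul, mul_add, mul_sub,
    smul_mul_assoc, mul_smul_comm, mul_assoc, smul_add, smul_sub, inv_smul_smul₀ hq,
    smul_inv_smul₀ hq]
  match_scalars <;> field_simp <;> ring

set_option maxHeartbeats 4000000 in
theorem B_eq (hq : q ≠ 0) (hq1 : q ^ 2 - 1 ≠ 0)
    (h : PBW q x1 x2 x3 f123 f23 f13 f12 g f1 f2 f3 y) {z1 z2 : A}
    (h1 : z1 = nz1 q x1 x2 x3 f123 f23 f13 f12 f1 f2 f3)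
    (h2 : z2 = nz2 q x1 x2 x3 f123 f23 f13 f12 f1 f2 f3) :
    qc z2 y q⁻¹ = nB q x1 x2 x3 f23 f13 f12 g f1 f2 f3 := by
  have hd : q - q⁻¹ = (q ^ 2 - 1) / q := by field_simp
  subst h1 h2
  simp only [qc, nz2, nB, hd, h.rules, h.rules_assoc, add_mul, sub_mul, mul_add, mul_sub,
    smul_mul_assoc, mul_smul_comm, mul_assoc, smul_add, smul_sub, inv_smul_smul₀ hq,
    smul_inv_smul₀ hq]
  match_scalars <;> field_simp <;> ring

set_option maxHeartbeats 4000000 in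
theorem id3 (hq : q ≠ 0) (hq1 : q ^ 2 - 1 ≠ 0)
    (h : PBW q x1 x2 x3 f123 f23 f13 f12 g f1 f2 f3 y) {z1 z2 r : A}
    (h1 : z1 = nz1 q x1 x2 x3 f123 f23 f13 f12 f1 f2 f3)
    (h2 : z2 = nz2 q x1 x2 x3 f123 f23 f13 f12 f1 f2 f3)
    (hr : r = nwu x1 x2 x3 f123 f23 f13 f12 f1 f2 f3) :
    qc z1 z2 (1 : K) = (q + q⁻¹) • qc z1 r (1 : K) - qc z2 r (1 : K) := by
  have hd : q - q⁻¹ = (q ^ 2 - 1) / q := by field_simp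
  subst h1 h2 hr
  simp only [qc, nz1, nz2, nwu, hd, h.rules, h.rules_assoc, add_mul, sub_mul, mul_add, mul_sub,
    smul_mul_assoc, mul_smul_comm, mul_assoc, smul_add, smul_sub, inv_smul_smul₀ hq,
    smul_inv_smul₀ hq]
  match_scalars <;> field_simp <;> ring

set_option maxHeartbeats 4000000 in
theorem id4b (hq : q ≠ 0) (hq1 : q ^ 2 - 1 ≠ 0)
    (h : PBW q x1 x2 x3 f123 f23 f13 f12 g f1 f2 f3 y) {z1 z2 a b : A}
    (h1 : z1 = nz1 q x1 x2 x3 f123 f23 f13 f12 f1 f2 f3)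
    (h2 : z2 = nz2 q x1 x2 x3 f123 f23 f13 f12 f1 f2 f3)
    (ha : a = nA q x1 x2 x3 f23 f13 f12 g f1 f2 f3) (hb : b = nB q x1 x2 x3 f23 f13 f12 g f1 f2 f3) :
    qc z1 a q = qc z2 b q := by
  have hd : q - q⁻¹ = (q ^ 2 - 1) / q := by field_simp
  subst h1 h2 ha hb
  simp only [qc, nz1, nz2, nA, nB, hd, h.rules, h.rules_assoc, add_mul, sub_mul, mul_add, mul_sub,
    smul_mul_assoc, mul_smul_comm, mul_assoc, smul_add, smul_sub, inv_smul_smul₀ hq,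
    smul_inv_smul₀ hq]
  match_scalars <;> field_simp <;> ring

set_option maxHeartbeats 4000000 in
theorem id5 (hq : q ≠ 0) (hq1 : q ^ 2 - 1 ≠ 0)
    (h : PBW q x1 x2 x3 f123 f23 f13 f12 g f1 f2 f3 y) {z1 z2 a b : A}
    (h1 : z1 = nz1 q x1 x2 x3 f123 f23 f13 f12 f1 f2 f3)
    (h2 : z2 = nz2 q x1 x2 x3 f123 f23 f13 f12 f1 f2 f3)
    (ha : a = nA q x1 x2 x3 f23 f13 f12 g f1 f2 f3) (hb : b = nB q x1 x2 x3 f23 f13 f12 g f1 f2 f3) :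
    qc z1 a q = q • (qc z1 b q + qc z2 a q) + (q - q⁻¹) • (q • (a * z2) - z1 * b) := by
  have hd : q - q⁻¹ = (q ^ 2 - 1) / q := by field_simp
  subst h1 h2 ha hb
  simp only [qc, nz1, nz2, nA, nB, hd, h.rules, h.rules_assoc, add_mul, sub_mul, mul_add, mul_sub,
    smul_mul_assoc, mul_smul_comm, mul_assoc, smul_add, smul_sub, inv_smul_smul₀ hq,
    smul_inv_smul₀ hq]
  match_scalars <;> field_simp <;> ring

end Main

end PBWTheory

theorem qq_ne : qq ≠ 0 := RatFunc.X_ne_zero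

theorem qq_eq : qq = algebraMap (Polynomial ℂ) Kq Polynomial.X := RatFunc.algebraMap_X.symm

theorem qq_sq_add : qq ^ 2 + 1 ≠ 0 := by
  have : qq ^ 2 + 1 = algebraMap (Polynomial ℂ) Kq (Polynomial.X ^ 2 + Polynomial.C 1) := by
    rw [qq_eq]; simp
  rw [this]
  exact RatFunc.algebraMap_ne_zero (Polynomial.X_pow_add_C_ne_zero (by norm_num) 1)

theorem qq_sq_sub : qq ^ 2 - 1 ≠ 0 := by
  have : qq ^ 2 - 1 = algebraMap (Polynomial ℂ) Kq (Polynomial.X ^ 2 - Polynomial.C 1) := by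
    rw [qq_eq]; simp
  rw [this]
  exact RatFunc.algebraMap_ne_zero (Polynomial.X_pow_sub_C_ne_zero (by norm_num) 1)

theorem EE_comm (i j : Fin 4) (hij : i ≠ j) (hi : i ≠ 0) (hj : j ≠ 0) :
    EE i * EE j = EE j * EE i := by
  simpa only [EE, map_mul] using RingQuot.mkAlgHom_rel Kq (SO8Rel.comm i j hij hi hj)

theorem EE_serre₁ (i : Fin 4) (hi : i ≠ 0) :
    EE i * EE i * EE 0 + EE 0 * EE i * EE i = (qq + qq⁻¹) • (EE i * EE 0 * EE i) := by
  simpa only [EE, map_mul, map_add, map_smul] using RingQuot.mkAlgHom_rel Kq (SO8Rel.serre₁ i hi)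

theorem EE_serre₂ (i : Fin 4) (hi : i ≠ 0) :
    EE 0 * EE 0 * EE i + EE i * EE 0 * EE 0 = (qq + qq⁻¹) • (EE 0 * EE i * EE 0) := by
  simpa only [EE, map_mul, map_add, map_smul] using RingQuot.mkAlgHom_rel Kq (SO8Rel.serre₂ i hi)

theorem cmt_eq_qc (a b : UqSO8) (v : Kq) : cmt a b v = qc a b v := rfl

/-- **Serre-like relations in the quantum folding `(so₈, G₂)`** (Theorem on the folding
`(so₈,G₂)`, part (iii)): the elements `u, w, z₁, z₂` of `U_q^+(so₈)` satisfy the listed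
identities. -/
theorem so8_G2_folding_relations :
    (cmt uu (cmt uu (cmt uu (cmt uu ww (qq⁻¹ ^ 3)) qq⁻¹) qq) (qq ^ 3) = 0) ∧
    (cmt ww (cmt ww uu (qq⁻¹ ^ 3)) (qq ^ 3) = cmt ww zz1 (qq ^ 3) ∧
      cmt ww zz1 (qq ^ 3) = cmt zz2 ww (qq ^ 3) ∧
      cmt zz2 ww (qq ^ 3) = qq • (cmt zz1 ww qq + cmt ww zz2 qq)) ∧
    (cmt zz1 zz2 1 =
      (qq + qq⁻¹) • cmt zz1 (cmt ww uu (qq⁻¹ ^ 3)) 1 - cmt zz2 (cmt ww uu (qq⁻¹ ^ 3)) 1) ∧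
    (cmt zz1 (cmt uu ww qq) 1 = cmt (cmt ww uu qq) zz2 1 ∧
      cmt zz1 (cmt zz1 uu qq⁻¹) qq = cmt zz2 (cmt zz2 uu qq⁻¹) qq) ∧
    (cmt zz1 (cmt zz1 uu qq⁻¹) qq =
      qq • (cmt zz1 (cmt zz2 uu qq⁻¹) qq + cmt zz2 (cmt zz1 uu qq⁻¹) qq)
        + (qq - qq⁻¹) • (qq • (cmt zz1 uu qq⁻¹ * zz2) - zz1 * cmt zz2 uu qq⁻¹)) := by
  have h := PBW.build (q := qq) (x1 := EE 1) (x2 := EE 2) (x3 := EE 3) (y := EE 0)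
    qq_ne qq_sq_add
    (EE_comm 2 1 (by decide) (by decide) (by decide))
    (EE_comm 3 1 (by decide) (by decide) (by decide))
    (EE_comm 3 2 (by decide) (by decide) (by decide))
    (EE_serre₁ 1 (by decide)) (EE_serre₁ 2 (by decide)) (EE_serre₁ 3 (by decide))
    (EE_serre₂ 1 (by decide)) (EE_serre₂ 2 (by decide)) (EE_serre₂ 3 (by decide))
    rfl rfl rfl rfl rfl rfl rfl rfl
  have h1 : zz1 = _ := z1_eq qq_ne qq_sq_sub h
  have h2 : zz2 = _ := z2_eq qq_ne qq_sq_sub h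
  have hr : qc ww uu (qq⁻¹ ^ 3) = _ := wu_eq qq_ne h
  have ha : qc zz1 uu qq⁻¹ = _ := A_eq qq_ne qq_sq_sub h h1 h2
  have hb : qc zz2 uu qq⁻¹ = _ := B_eq qq_ne qq_sq_sub h h1 h2
  have hw : ww = EE 1 * EE 2 * EE 3 := rfl
  simp only [cmt_eq_qc]
  exact ⟨id1 qq_ne h,
    ⟨id2a qq_ne qq_sq_sub h hw h1 h2, id2b qq_ne qq_sq_sub h hw h1 h2,
      id2c qq_ne qq_sq_sub h hw h1 h2⟩,
    id3 qq_ne qq_sq_sub h h1 h2 hr,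
    ⟨id4a qq_ne qq_sq_sub h hw h1 h2, id4b qq_ne qq_sq_sub h h1 h2 ha hb⟩,
    id5 qq_ne qq_sq_sub h h1 h2 ha hb⟩

end
end
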